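/- arXiv:math/0304051 — 2 statements merged into one kernel-verified Lean document; each statement's English description precedes it below -/
import Mathlib

section
/- Let (R, 𝔪) be an excellent Noetherian local domain of prime characteristic p > 0 with residue field k = R/𝔪, and let 𝔞 be an ideal of R defining the singular locus of R (i.e. for every prime 𝔭 of R, the localization R_𝔭 is regular if and only if 𝔞 ⊄ 𝔭). If Tor_1^R(R^+, k) = 0, then Tor_n^R(R^+, M) = 0 for every n ≥ 1 and every finitely generated R-module M such that M/𝔞M has finite length. -/
set_option synthInstance.maxHeartbeats 1000000
set_option maxHeartbeats 1000000
set_option linter.unusedVariables false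

open CategoryTheory

/-- `Tor_n^R(M, N)`, the `n`-th Tor group of the `R`-modules `M` and `N`. -/
noncomputable abbrev TorGrp (R : Type) [CommRing R] (n : ℕ)
    (M N : Type) [AddCommGroup M] [Module R M] [AddCommGroup N] [Module R N] : Type :=
  ((Tor (ModuleCat R) n).obj (ModuleCat.of R M)).obj (ModuleCat.of R N)

/-- The absolute integral closure `R⁺` of a domain `R`: the integral closure of `R`
in an algebraic closure of its fraction field. -/
noncomputable abbrev AbsIntClo (R : Type) [CommRing R] [IsDomain R] : Type :=
  integralClosure R (AlgebraicClosure (FractionRing R))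

/-- A regular local ring: a Noetherian local ring whose maximal ideal can be generated
by Krull-dimension many elements. -/
def IsRegularLocalRingP (A : Type) [CommRing A] : Prop :=
  IsNoetherianRing A ∧ ∃ h : IsLocalRing A, ∃ s : Finset A,
    Ideal.span (s : Set A) = @IsLocalRing.maximalIdeal A _ h ∧
      (s.card : WithBot ℕ∞) = ringKrullDim A

/-- A regular ring: a Noetherian ring all of whose localizations at primes are
regular local rings. -/
def IsRegularRingP (A : Type) [CommRing A] : Prop :=
  IsNoetherianRing A ∧
    ∀ (p : Ideal A) (hp : p.IsPrime),
      haveI := hp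
      IsRegularLocalRingP (Localization.AtPrime p)

/-- A chain of primes is saturated if each step is a covering relation. -/
def IsSaturatedChain {α : Type} [Preorder α] (c : LTSeries α) : Prop :=
  ∀ i : Fin c.length, c.toFun i.castSucc ⋖ c.toFun i.succ

/-- A ring is catenary if any two saturated chains of primes with the same endpoints
have the same length. -/
def IsCatenaryRing (A : Type) [CommRing A] : Prop :=
  ∀ c₁ c₂ : LTSeries (PrimeSpectrum A),
    c₁.head = c₂.head → c₁.last = c₂.last →
      IsSaturatedChain c₁ → IsSaturatedChain c₂ → c₁.length = c₂.length

/-- A ring is universally catenary if every finitely generated algebra over it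
(i.e. every quotient of a polynomial ring over it) is catenary. -/
def IsUniversallyCatenary (A : Type) [CommRing A] : Prop :=
  ∀ (n : ℕ) (I : Ideal (MvPolynomial (Fin n) A)),
    IsCatenaryRing (MvPolynomial (Fin n) A ⧸ I)

/-- A `κ`-algebra `B` is geometrically regular if `L ⊗_κ B` is a regular ring for
every finite field extension `L` of `κ`. -/
def IsGeometricallyRegularAlgebra (κ : Type) [Field κ] (B : Type) [CommRing B]
    [Algebra κ B] : Prop :=
  ∀ (L : Type) (_ : Field L) (_ : Algebra κ L) (_ : Module.Finite κ L),
    IsRegularRingP (TensorProduct κ L B)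

/-- A ring `A` is a G-ring if for every prime `p` of `A`, all fibers of the completion
map `A_p → (A_p)^∧` are geometrically regular; the fiber at a prime `q` of `A_p` is
`κ(q) ⊗_{A_p} (A_p)^∧`. -/
def IsGRing (A : Type) [CommRing A] : Prop :=
  ∀ (p : Ideal A) (hp : p.IsPrime),
    haveI := hp
    ∀ (q : Ideal (Localization.AtPrime p)) (hq : q.IsPrime),
      haveI := hq
      IsGeometricallyRegularAlgebra
        (IsLocalRing.ResidueField (Localization.AtPrime q))
        (TensorProduct (Localization.AtPrime p)
          (IsLocalRing.ResidueField (Localization.AtPrime q))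
          (AdicCompletion (IsLocalRing.maximalIdeal (Localization.AtPrime p))
            (Localization.AtPrime p)))

/-- A ring `A` is J-2 if the regular locus of every finitely generated `A`-algebra
is open in its prime spectrum. -/
def IsJ2 (A : Type) [CommRing A] : Prop :=
  ∀ (n : ℕ) (I : Ideal (MvPolynomial (Fin n) A)),
    IsOpen {p : PrimeSpectrum (MvPolynomial (Fin n) A ⧸ I) |
      IsRegularLocalRingP (Localization.AtPrime p.asIdeal)}

/-- A ring is excellent if it is Noetherian, universally catenary, a G-ring, and J-2. -/
def IsExcellentRing (A : Type) [CommRing A] : Prop :=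
  IsNoetherianRing A ∧ IsUniversallyCatenary A ∧ IsGRing A ∧ IsJ2 A

/-- A list of elements of a local ring is a system of parameters if its elements lie in
the maximal ideal, its length is the Krull dimension, and the ideal it generates has
radical the maximal ideal (i.e. is primary to the maximal ideal). -/
def IsSystemOfParameters (R : Type) [CommRing R] [IsLocalRing R] (rs : List R) : Prop :=
  (∀ x ∈ rs, x ∈ IsLocalRing.maximalIdeal R) ∧
    (rs.length : WithBot ℕ∞) = ringKrullDim R ∧
    (Ideal.ofList rs).radical = IsLocalRing.maximalIdeal R

/-- A local ring is Cohen-Macaulay if it is Noetherian and admits a regular sequence of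
length equal to its Krull dimension consisting of elements of the maximal ideal. -/
def IsCohenMacaulayLocalRing (R : Type) [CommRing R] : Prop :=
  IsNoetherianRing R ∧ ∃ h : IsLocalRing R,
    ∃ rs : List R, (∀ x ∈ rs, x ∈ @IsLocalRing.maximalIdeal R _ h) ∧
      RingTheory.Sequence.IsRegular R rs ∧ (rs.length : WithBot ℕ∞) = ringKrullDim R

/-- An `R`-algebra `S` is a big Cohen-Macaulay `R`-algebra if some system of parameters
of `R` is an `S`-regular sequence. -/
def IsBigCohenMacaulayAlgebra (R : Type) [CommRing R] [IsLocalRing R]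
    (S : Type) [CommRing S] [Algebra R S] : Prop :=
  ∃ rs : List R, IsSystemOfParameters R rs ∧ RingTheory.Sequence.IsRegular S rs

section Lech

variable {ι Y : Type*} [Fintype ι] [DecidableEq ι] [CommRing Y]

/-- Independence in the sense of Lech: the coefficients of every linear relation among the `f i`
lie in the ideal generated by the `f i`. -/
def LechIndependent (f : ι → Y) : Prop :=
  ∀ b : ι → Y, ∑ i, b i * f i = 0 → ∀ i, b i ∈ Ideal.span (Set.range f)

theorem mem_span_range_iff_exists_sum {f : ι → Y} {y : Y} :
    y ∈ Ideal.span (Set.range f) ↔ ∃ c : ι → Y, ∑ i, c i * f i = y := by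
  rw [Ideal.span, Submodule.mem_span_range_iff_exists_fun]
  simp [smul_eq_mul]

theorem sum_mul_update (b f : ι → Y) (j : ι) (z : Y) :
    ∑ i, b i * Function.update f j z i = ∑ i, b i * f i + b j * (z - f j) := by
  rw [← Finset.add_sum_erase _ _ (Finset.mem_univ j), ← Finset.add_sum_erase _ (fun i => b i * f i)
    (Finset.mem_univ j)]
  have : ∑ i ∈ Finset.univ.erase j, b i * Function.update f j z i
      = ∑ i ∈ Finset.univ.erase j, b i * f i :=
    Finset.sum_congr rfl fun i hi => by rw [Function.update_of_ne (Finset.ne_of_mem_erase hi)]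
  rw [this, Function.update_self]
  ring

theorem sum_update_mul (b f : ι → Y) (j : ι) (z : Y) :
    ∑ i, Function.update b j z i * f i = ∑ i, b i * f i + (z - b j) * f j := by
  have := sum_mul_update f b j z
  simp only [mul_comm (f _)] at this
  exact this

theorem span_range_le_update {f : ι → Y} {j : ι} {g : Y} (h : g ∣ f j) :
    Ideal.span (Set.range f) ≤ Ideal.span (Set.range (Function.update f j g)) := by
  rw [Ideal.span_le]
  rintro _ ⟨i, rfl⟩
  by_cases hi : i = j
  · subst hi
    obtain ⟨c, hc⟩ := h
    rw [hc]
    exact Ideal.mul_mem_right _ _ (Ideal.subset_span ⟨i, Function.update_self ..⟩)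
  · exact Ideal.subset_span ⟨i, Function.update_of_ne hi ..⟩

theorem LechIndependent.colon {f : ι → Y} (hf : LechIndependent f) {j : ι} {g h c : Y}
    (hj : f j = g * h) (hc : c * g ∈ Ideal.span (Set.range f)) :
    c ∈ Ideal.span (Set.range (Function.update f j h)) := by
  obtain ⟨b, hb⟩ := mem_span_range_iff_exists_sum.1 hc
  have key := hf (Function.update (fun i => - (h * b i)) j (c - b j * h)) (by
    rw [sum_update_mul]
    simp only [neg_mul, Finset.sum_neg_distrib, mul_assoc, ← Finset.mul_sum, hb, hj]
    ring) j
  rw [Function.update_self] at key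
  have h1 := span_range_le_update (Dvd.intro_left g hj.symm) key
  have h2 : b j * h ∈ Ideal.span (Set.range (Function.update f j h)) :=
    Ideal.mul_mem_left _ _ (Ideal.subset_span ⟨j, Function.update_self ..⟩)
  simpa using add_mem h1 h2

theorem LechIndependent.update {f : ι → Y} (hf : LechIndependent f) {j : ι} {g h : Y}
    (hj : f j = g * h) : LechIndependent (Function.update f j g) := by
  intro b hb
  have hle := span_range_le_update (Dvd.intro h hj.symm)
  rw [sum_mul_update, hj] at hb
  have h1 : ∑ i, Function.update (fun i => h * b i) j (b j) i * f i = 0 := by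
    rw [sum_update_mul]
    simp only [mul_assoc, ← Finset.mul_sum, hj]
    linear_combination h * hb
  have h2 := hf _ h1 j
  rw [Function.update_self] at h2
  obtain ⟨c, hc⟩ := mem_span_range_iff_exists_sum.1 h2
  have h3 : ∑ i, Function.update (fun i => b i + c i * g) j (c j * g) i * f i = 0 := by
    rw [sum_update_mul]
    simp only [add_mul, Finset.sum_add_distrib, mul_right_comm _ g, ← Finset.sum_mul, hc, hj]
    linear_combination hb
  intro i
  by_cases hi : i = j
  · subst hi; exact hle h2
  · have h4 := hle (hf _ h3 i)
    rw [Function.update_of_ne hi] at h4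
    have h5 : c i * g ∈ Ideal.span (Set.range (Function.update f j g)) :=
      Ideal.mul_mem_left _ _ (Ideal.subset_span ⟨j, Function.update_self ..⟩)
    simpa using sub_mem h4 h5

theorem LechIndependent.of_mul {g h : ι → Y} (hf : LechIndependent fun i => g i * h i) :
    LechIndependent g := by
  have : ∀ s : Finset ι, LechIndependent fun i => if i ∈ s then g i else g i * h i := by
    intro s
    induction s using Finset.induction_on with
    | empty => simpa using hf
    | insert j s hj ih =>
      have := ih.update (j := j) (g := g j) (h := h j) (by simp [hj])
      convert this using 1
      ext i
      by_cases hi : i = j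
      · subst hi; simp
      · simp [hi, Finset.mem_insert]
  simpa using this Finset.univ

theorem LechIndependent.pow_mono {x : ι → Y} {a b : ι → ℕ}
    (hf : LechIndependent fun i => x i ^ a i) (hab : ∀ i, b i ≤ a i) :
    LechIndependent fun i => x i ^ b i :=
  LechIndependent.of_mul (h := fun i => x i ^ (a i - b i)) <| by
    simpa only [← pow_add, Nat.add_sub_cancel' (hab _)] using hf

theorem update_pow (x : ι → Y) (a : ι → ℕ) (j : ι) (n : ℕ) :
    Function.update (fun i => x i ^ a i) j (x j ^ n) =
      fun i => x i ^ Function.update a j n i := by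
  ext i
  by_cases hi : i = j
  · subst hi; simp
  · simp [hi]

theorem LechIndependent.frobenius {p : ℕ} [hp : Fact p.Prime] [CharP Y p] {x : ι → Y}
    (hY : ∀ y : Y, ∃ z, z ^ p = y) (hinj : ∀ y : Y, y ^ p = 0 → y = 0) (hf : LechIndependent x) :
    LechIndependent fun i => x i ^ p := by
  intro b hb i
  choose r hr using hY
  have h1 : (∑ i, r (b i) * x i) ^ p = 0 := by
    rw [sum_pow_char]
    simpa only [mul_pow, hr] using hb
  obtain ⟨c, hc⟩ := mem_span_range_iff_exists_sum.1 (hf _ (hinj _ h1) i)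
  rw [← hr (b i), ← hc, sum_pow_char]
  exact mem_span_range_iff_exists_sum.2 ⟨fun i => c i ^ p, by simp only [mul_pow]⟩

theorem LechIndependent.pow {p : ℕ} [hp : Fact p.Prime] [CharP Y p] {x : ι → Y}
    (hY : ∀ y : Y, ∃ z, z ^ p = y) (hinj : ∀ y : Y, y ^ p = 0 → y = 0) (hf : LechIndependent x)
    (a : ι → ℕ) : LechIndependent fun i => x i ^ a i := by
  have : ∀ e : ℕ, LechIndependent fun i => x i ^ p ^ e := by
    intro e
    induction e with
    | zero => simpa using hf
    | succ e ih => simpa only [pow_succ, pow_mul] using ih.frobenius hY hinj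
  obtain ⟨e, he⟩ : ∃ e, ∀ i, a i ≤ p ^ e :=
    ⟨∑ i, a i, fun i => (Finset.single_le_sum (fun _ _ => Nat.zero_le _) (Finset.mem_univ i)).trans
      (Nat.lt_pow_self hp.out.one_lt).le⟩
  exact LechIndependent.pow_mono (a := fun _ => p ^ e) (this e) he

end Lech

section Contraction

variable {ι A Y : Type*} [Fintype ι] [DecidableEq ι] [CommRing A] [CommRing Y] [Algebra A Y]

/-- Ideals generated by powers of `x` are contracted from an algebra on which all powers are Lech
independent, once `(x)` itself is. -/
theorem mem_span_pow_of_algebraMap_mem (x : ι → A)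
    (hind : ∀ a : ι → ℕ, LechIndependent fun i => algebraMap A Y (x i) ^ a i)
    (hx : ∀ r : A, algebraMap A Y r ∈ Ideal.span (Set.range fun i => algebraMap A Y (x i)) →
      r ∈ Ideal.span (Set.range x)) (n : ℕ) :
    ∀ (a : ι → ℕ), ∑ i, a i = n → ∀ r : A,
      algebraMap A Y r ∈ Ideal.span (Set.range fun i => algebraMap A Y (x i) ^ a i) →
      r ∈ Ideal.span (Set.range fun i => x i ^ a i) := by
  induction n using Nat.strong_induction_on with
  | _ n ih =>
  intro a han r hr
  by_cases h0 : ∃ j, a j = 0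
  · obtain ⟨j, hj⟩ := h0
    have : Ideal.span (Set.range fun i => x i ^ a i) = ⊤ :=
      (Ideal.eq_top_iff_one _).2 (Ideal.subset_span ⟨j, by simp [hj]⟩)
    rw [this]; trivial
  push Not at h0
  by_cases h1 : ∀ j, a j = 1
  · simp only [h1, pow_one] at hr ⊢
    exact hx r hr
  push Not at h1
  obtain ⟨j, hj⟩ := h1
  have hj2 : 2 ≤ a j := by have := h0 j; omega
  have hsum : ∀ m, ∑ i, Function.update a j m i + a j = n + m := by
    intro m
    rw [Finset.sum_update_of_mem (Finset.mem_univ j), ← han,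
      ← Finset.add_sum_erase _ a (Finset.mem_univ j), Finset.sdiff_singleton_eq_erase]
    ring
  have hr1 : r ∈ Ideal.span (Set.range fun i => x i ^ Function.update a j 1 i) := by
    refine ih _ ?_ _ rfl r ?_
    · have := hsum 1; omega
    · have hdvd : algebraMap A Y (x j) ^ 1 ∣ algebraMap A Y (x j) ^ a j :=
        pow_dvd_pow _ (Nat.one_le_iff_ne_zero.2 (h0 j))
      have := span_range_le_update (f := fun i => algebraMap A Y (x i) ^ a i) hdvd hr
      rwa [update_pow (fun i => algebraMap A Y (x i)) a j 1] at this
  rw [← update_pow x] at hr1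
  obtain ⟨c, hc⟩ := mem_span_range_iff_exists_sum.1 hr1
  rw [sum_mul_update, pow_one] at hc
  have hdec : r = c j * x j + ∑ i, Function.update c j 0 i * x i ^ a i := by
    rw [sum_update_mul, ← hc]; ring
  have hmem : ∑ i, Function.update c j 0 i * x i ^ a i ∈
      Ideal.span (Set.range fun i => x i ^ a i) := mem_span_range_iff_exists_sum.2 ⟨_, rfl⟩
  have hcx : algebraMap A Y (c j) * algebraMap A Y (x j) ∈
      Ideal.span (Set.range fun i => algebraMap A Y (x i) ^ a i) := by
    have h2 : algebraMap A Y (∑ i, Function.update c j 0 i * x i ^ a i) ∈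
        Ideal.span (Set.range fun i => algebraMap A Y (x i) ^ a i) :=
      mem_span_range_iff_exists_sum.2
        ⟨fun i => algebraMap A Y (Function.update c j 0 i), by
          simp only [map_sum, map_mul, map_pow]⟩
    rw [hdec, map_add, map_mul] at hr
    simpa using sub_mem hr h2
  have haj : a j = a j - 1 + 1 := by omega
  have hpow : x j ^ a j = x j * x j ^ (a j - 1) := by rw [← pow_succ', ← haj]
  have hpowY : algebraMap A Y (x j) ^ a j =
      algebraMap A Y (x j) * algebraMap A Y (x j) ^ (a j - 1) := by rw [← pow_succ', ← haj]
  have hcol := (hind a).colon (j := j) (g := algebraMap A Y (x j)) hpowY hcx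
  rw [update_pow (fun i => algebraMap A Y (x i))] at hcol
  have hcA := ih _ (by have := hsum (a j - 1); omega) _ rfl (c j) hcol
  rw [← update_pow x] at hcA
  obtain ⟨d, hd⟩ := mem_span_range_iff_exists_sum.1 hcA
  rw [sum_mul_update] at hd
  rw [hdec]
  refine add_mem ?_ hmem
  rw [← hd, add_mul, Finset.sum_mul]
  refine add_mem (sum_mem fun i _ => ?_) ?_
  · exact Ideal.mul_mem_right _ _ (Ideal.mul_mem_left _ _ (Ideal.subset_span ⟨i, rfl⟩))
  · have : d j * (x j ^ (a j - 1) - x j ^ a j) * x j = (d j * (1 - x j)) * x j ^ a j := by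
      linear_combination (-d j) * hpow
    rw [this]
    exact Ideal.mul_mem_left _ _ (Ideal.subset_span ⟨j, rfl⟩)

/-- If all powers of generators `x` of the maximal ideal are Lech independent in `Y`, then each
`x t` is a nonzerodivisor modulo any subset of the others. -/
theorem mem_span_image_of_mul_mem_of_lechIndependent [IsLocalRing A] [IsNoetherianRing A]
    (x : ι → A) (hm : ∀ i, x i ∈ IsLocalRing.maximalIdeal A)
    (hind : ∀ a : ι → ℕ, LechIndependent fun i => algebraMap A Y (x i) ^ a i)
    (hx : ∀ r : A, algebraMap A Y r ∈ Ideal.span (Set.range fun i => algebraMap A Y (x i)) →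
      r ∈ Ideal.span (Set.range x)) (J : Set ι) (t : ι) (ht : t ∉ J) (r : A)
    (hr : r * x t ∈ Ideal.span (x '' J)) : r ∈ Ideal.span (x '' J) := by
  classical
  have key : ∀ q, r ∈ Ideal.span (x '' J) ⊔ IsLocalRing.maximalIdeal A ^ q := by
    intro q
    let e : ι → ℕ := fun i => if i ∈ J then 1 else q + 1
    have h1 : algebraMap A Y r * algebraMap A Y (x t) ∈
        Ideal.span (Set.range fun i => algebraMap A Y (x i) ^ e i) := by
      rw [← map_mul]
      have := Ideal.mem_map_of_mem (algebraMap A Y) hr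
      rw [Ideal.map_span] at this
      refine Ideal.span_mono ?_ this
      rintro _ ⟨_, ⟨i, hi, rfl⟩, rfl⟩
      exact ⟨i, by simp [e, hi]⟩
    have h2 := (hind e).colon (j := t) (h := algebraMap A Y (x t) ^ q)
      (by simp [e, ht, pow_succ']) h1
    rw [update_pow (fun i => algebraMap A Y (x i))] at h2
    have h3 := mem_span_pow_of_algebraMap_mem x hind hx _ _ rfl r h2
    refine (Ideal.span_le.2 ?_) h3
    rintro _ ⟨i, rfl⟩
    by_cases hi : i ∈ J
    · refine Ideal.mem_sup_left (Ideal.subset_span ⟨i, hi, ?_⟩)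
      have : i ≠ t := fun h => ht (h ▸ hi)
      simp [this, e, hi]
    · refine Ideal.mem_sup_right ?_
      have : q ≤ Function.update e t q i := by
        by_cases h : i = t
        · subst h; simp
        · simp [h, e, hi]
      exact Ideal.pow_le_pow_right this (Ideal.pow_mem_pow (hm i) _)
  have hKrull := Ideal.iInf_pow_smul_eq_bot_of_isLocalRing (M := A ⧸ Ideal.span (x '' J))
    (IsLocalRing.maximalIdeal A) Ideal.IsPrime.ne_top'
  rw [← Ideal.Quotient.eq_zero_iff_mem, ← Submodule.mem_bot A, ← hKrull, Submodule.mem_iInf]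
  intro q
  obtain ⟨u, hu, v, hv, huv⟩ := Submodule.mem_sup.1 (key q)
  rw [← huv, map_add, Ideal.Quotient.eq_zero_iff_mem.2 hu, zero_add]
  have : (Ideal.Quotient.mk (Ideal.span (x '' J)) v) = v • (1 : A ⧸ Ideal.span (x '' J)) := by
    rw [Algebra.smul_def, mul_one]; rfl
  rw [this]
  exact Submodule.smul_mem_smul hv trivial

end Contraction

section RegularLocal

open IsLocalRing
open scoped Pointwise

theorem Ideal.exists_list_of_mem_ofList {A : Type*} [CommRing A] [IsLocalRing A] (l : List A) :
    ∀ x ∈ Ideal.ofList l, x ∉ maximalIdeal A * Ideal.ofList l →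
      ∃ l' : List A, l'.length + 1 = l.length ∧ Ideal.ofList (x :: l') = Ideal.ofList l := by
  induction l with
  | nil => intro x hx hx'; simp at hx; simp [hx] at hx'
  | cons a l ih =>
    intro x hx hx'
    rw [Ideal.ofList_cons] at hx hx'
    obtain ⟨_, h1, y, hy, rfl⟩ := Submodule.mem_sup.1 hx
    obtain ⟨c, rfl⟩ := Ideal.mem_span_singleton'.1 h1
    by_cases hc : IsUnit c
    · refine ⟨l, rfl, ?_⟩
      rw [Ideal.ofList_cons, Ideal.ofList_cons]
      apply le_antisymm <;> rw [sup_le_iff] <;> refine ⟨?_, le_sup_right⟩ <;>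
        rw [Ideal.span_singleton_le_iff_mem]
      · exact hx
      · rw [← Ideal.unit_mul_mem_iff_mem _ hc]
        have h2 := sub_mem (Ideal.mem_sup_left (Ideal.mem_span_singleton_self (c * a + y)))
          (Ideal.mem_sup_right hy)
        rwa [add_sub_cancel_right] at h2
    · have hcm : c ∈ maximalIdeal A := hc
      have hca : c * a ∈ maximalIdeal A * (Ideal.span {a} ⊔ Ideal.ofList l) :=
        Ideal.mul_mem_mul hcm (Ideal.mem_sup_left (Ideal.mem_span_singleton_self _))
      obtain ⟨l', hl', he⟩ := ih y hy fun h =>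
        hx' (add_mem hca (Ideal.mul_mono_right le_sup_right h))
      refine ⟨a :: l', by simp [hl'], ?_⟩
      rw [Ideal.ofList_cons] at he
      simp only [Ideal.ofList_cons]
      apply le_antisymm
      · refine sup_le ?_ (sup_le le_sup_left (le_trans ?_ le_sup_right))
        · rwa [Ideal.span_singleton_le_iff_mem]
        · rw [← he]; exact le_sup_right
      · refine sup_le (le_sup_left.trans le_sup_right) ?_
        rw [← he]
        refine sup_le ?_ (le_sup_right.trans le_sup_right)
        rw [Ideal.span_singleton_le_iff_mem]
        have h2 := sub_mem (Ideal.mem_sup_left (Ideal.mem_span_singleton_self (c * a + y)))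
          (Ideal.mem_sup_right (Ideal.mem_sup_left (T := Ideal.ofList l')
            (Ideal.mul_mem_left _ c (Ideal.mem_span_singleton_self a))))
        rwa [add_sub_cancel_left] at h2

variable {A : Type*} [CommRing A] [IsLocalRing A] [IsNoetherianRing A]

theorem quotient_span_singleton_ofList {x : A} {l : List A}
    (hl : Ideal.ofList (x :: l) = maximalIdeal A) (hd : ((l.length + 1 : ℕ) : WithBot ℕ∞) ≤ ringKrullDim A) :
    ∃ _ : IsLocalRing (A ⧸ Ideal.span {x}),
      Ideal.ofList (l.map (Ideal.Quotient.mk (Ideal.span {x}))) =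
        maximalIdeal (A ⧸ Ideal.span {x}) ∧
      (l.length : WithBot ℕ∞) ≤ ringKrullDim (A ⧸ Ideal.span {x}) := by
  have hxm : x ∈ maximalIdeal A := by rw [← hl]; exact Ideal.subset_span (by simp)
  have : Nontrivial (A ⧸ Ideal.span {x}) := Ideal.Quotient.nontrivial_iff.2 fun h =>
    hxm (Ideal.span_singleton_eq_top.1 h)
  have hloc : IsLocalRing (A ⧸ Ideal.span {x}) :=
    IsLocalRing.of_surjective' (Ideal.Quotient.mk _) Ideal.Quotient.mk_surjective
  refine ⟨hloc, ?_, ?_⟩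
  · rw [← Ideal.map_ofList]
    have h1 : (maximalIdeal A).map (Ideal.Quotient.mk (Ideal.span {x})) =
        maximalIdeal (A ⧸ Ideal.span {x}) := by
      refine IsLocalRing.eq_maximalIdeal ((Ideal.map_eq_top_or_isMaximal_of_surjective _
        Ideal.Quotient.mk_surjective inferInstance).resolve_left fun h => ?_)
      have h2 := Ideal.comap_map_of_surjective _
        (Ideal.Quotient.mk_surjective (I := Ideal.span {x})) (maximalIdeal A)
      rw [h, Ideal.comap_top, ← RingHom.ker_eq_comap_bot, Ideal.mk_ker, sup_eq_left.2
        ((Ideal.span_singleton_le_iff_mem _).2 hxm)] at h2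
      exact Ideal.IsPrime.ne_top' h2.symm
    rw [← h1, ← hl, Ideal.ofList_cons, Ideal.map_sup]
    simp
  · have h2 := ringKrullDim_le_ringKrullDim_quotient_add_card ({x} : Finset A)
      (by simpa [IsLocalRing.ringJacobson_eq_maximalIdeal] using! hxm)
    have h3 := hd.trans h2
    rw [Finset.coe_singleton, Finset.card_singleton] at h3
    generalize ringKrullDim (A ⧸ Ideal.span {x}) = d at h3
    induction d with
    | bot => simp at h3
    | coe d =>
      norm_cast at h3 ⊢
      exact (ENat.add_le_add_iff_right ENat.one_ne_top).1 h3

theorem isDomain_of_ofList_eq_maximalIdeal (n : ℕ) :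
    ∀ (A : Type*) [CommRing A] [IsLocalRing A] [IsNoetherianRing A] (l : List A),
      l.length = n → Ideal.ofList l = maximalIdeal A → (n : WithBot ℕ∞) ≤ ringKrullDim A →
      IsDomain A := by
  induction n with
  | zero =>
    intro A _ _ _ l hn hl hd
    rw [List.length_eq_zero_iff.1 hn, Ideal.ofList_nil] at hl
    exact ((IsLocalRing.isField_iff_maximalIdeal_eq).2 hl.symm).isDomain
  | succ n ih =>
    intro A _ _ _ l hn hl hd
    have hfin : (insert (maximalIdeal A * maximalIdeal A) (minimalPrimes A)).Finite :=
      (minimalPrimes.finite_of_isNoetherianRing A).insert _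
    obtain ⟨x, hxm, hx⟩ : ∃ x ∈ maximalIdeal A,
        ∀ I ∈ insert (maximalIdeal A * maximalIdeal A) (minimalPrimes A), x ∉ I := by
      by_contra! hcon
      obtain ⟨I, hI, hmI⟩ := (Ideal.subset_union_prime_finite (f := id) hfin
        (maximalIdeal A * maximalIdeal A) (maximalIdeal A * maximalIdeal A)
        (fun I hI h _ => Ideal.IsMinimalPrime.isPrime (hI.resolve_left h))
        (I := maximalIdeal A)).1 fun x hx => by
          obtain ⟨I, hI, hxI⟩ := hcon x hx
          exact Set.mem_biUnion hI hxI
      have hdim0 : ringKrullDim A ≤ 0 := by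
        rw [← IsLocalRing.maximalIdeal_height_eq_ringKrullDim]
        have : (maximalIdeal A).height = 0 := by
          rw [Ideal.height_eq_zero_iff]
          rcases hI with rfl | hI
          · have hbot : maximalIdeal A = ⊥ := by
              refine Submodule.eq_bot_of_le_smul_of_le_jacobson_bot (maximalIdeal A) _
                (IsNoetherian.noetherian _) hmI (IsLocalRing.maximalIdeal_le_jacobson _)
            refine ⟨⟨inferInstance, bot_le⟩, fun q hq _ => hbot ▸ bot_le⟩
          · have hp : I.IsPrime := Ideal.IsMinimalPrime.isPrime hI
            have : maximalIdeal A = I := le_antisymm hmI (IsLocalRing.le_maximalIdeal hp.ne_top)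
            exact this ▸ hI
        rw [this]; rfl
      have := hd.trans hdim0
      norm_cast at this
    obtain ⟨l', hl', he⟩ := Ideal.exists_list_of_mem_ofList l x (hl ▸ hxm)
      (by rw [hl]; exact hx _ (Set.mem_insert _ _))
    have hn' : l'.length = n := by omega
    obtain ⟨hloc, h1, h2⟩ := quotient_span_singleton_ofList (he.trans hl) (by rw [hn']; exact hd)
    have hdom := ih (A ⧸ Ideal.span {x}) (l'.map (Ideal.Quotient.mk (Ideal.span {x})))
      (by simp [hn']) h1 (hn' ▸ h2)
    have hprime : (Ideal.span {x}).IsPrime := (Ideal.Quotient.isDomain_iff_prime _).1 hdom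
    obtain ⟨P, hP, hPx⟩ := Ideal.exists_minimalPrimes_le (I := (⊥ : Ideal A)) (J := Ideal.span {x})
      bot_le
    have hxP : x ∉ P := hx _ (Set.mem_insert_of_mem _ hP)
    have hPp : P.IsPrime := Ideal.IsMinimalPrime.isPrime hP
    have hP0 : P = ⊥ := by
      refine Submodule.eq_bot_of_le_smul_of_le_jacobson_bot (maximalIdeal A) P
        (IsNoetherian.noetherian _) ?_ (IsLocalRing.maximalIdeal_le_jacobson _)
      intro y hy
      obtain ⟨a, rfl⟩ := Ideal.mem_span_singleton'.1 (hPx hy)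
      rw [mul_comm]
      exact Submodule.smul_mem_smul hxm ((hPp.mem_or_mem hy).resolve_right hxP)
    have : (⊥ : Ideal A).IsPrime := hP0 ▸ hPp
    exact (IsDomain.of_bot_isPrime A)

theorem isWeaklyRegular_of_ofList_eq_maximalIdeal (n : ℕ) :
    ∀ (A : Type*) [CommRing A] [IsLocalRing A] [IsNoetherianRing A] (l : List A),
      l.length = n → Ideal.ofList l = maximalIdeal A → (n : WithBot ℕ∞) ≤ ringKrullDim A →
      RingTheory.Sequence.IsWeaklyRegular A l := by
  induction n with
  | zero =>
    intro A _ _ _ l hn hl hd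
    rw [List.length_eq_zero_iff.1 hn]
    simp
  | succ n ih =>
    classical
    intro A _ _ _ l hn hl hd
    have := isDomain_of_ofList_eq_maximalIdeal (n + 1) A l hn hl hd
    obtain ⟨x, l, rfl⟩ := List.exists_of_length_succ l hn
    have hn' : l.length = n := by simpa using hn
    obtain ⟨hloc, h1, h2⟩ := quotient_span_singleton_ofList hl (by rw [hn']; exact hd)
    have hx0 : x ≠ 0 := by
      rintro rfl
      have h3 : (maximalIdeal A).spanFinrank ≤ n := by
        rw [← hl, Ideal.ofList_cons]
        simp only [Set.singleton_zero, Ideal.span_zero, bot_sup_eq]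
        refine (Submodule.spanFinrank_span_le_ncard_of_finite l.finite_toSet).trans ?_
        rw [← hn', ← List.coe_toFinset, Set.ncard_coe_finset]
        exact l.toFinset_card_le
      have h4 := hd.trans ((ringKrullDim_le_spanFinrank_maximalIdeal A).trans (Nat.cast_le.2 h3))
      rw [Nat.cast_le] at h4
      omega
    have h3 := ih _ (l.map (algebraMap A (A ⧸ Ideal.span {x}))) (by simp [hn']) h1 (hn' ▸ h2)
    rw [RingTheory.Sequence.isWeaklyRegular_map_algebraMap_iff] at h3
    refine (RingTheory.Sequence.isWeaklyRegular_cons_iff A x l).2 ⟨IsSMulRegular.of_ne_zero hx0, ?_⟩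
    have h4 : x • (⊤ : Submodule A A) = Ideal.span {x} := by
      simp [← Submodule.ideal_span_singleton_smul]
    exact ((Submodule.quotEquivOfEq _ _ h4).isWeaklyRegular_congr l).2 h3

theorem le_ringKrullDim_of_isSMulRegular_mod {n : ℕ} (x : Fin n → A)
    (hm : Ideal.span (Set.range x) = maximalIdeal A)
    (hreg : ∀ (J : Set (Fin n)) (t : Fin n), t ∉ J → ∀ r : A,
      r * x t ∈ Ideal.span (x '' J) → r ∈ Ideal.span (x '' J)) :
    (n : WithBot ℕ∞) ≤ ringKrullDim A := by
  have hmem : ∀ r ∈ List.ofFn x, r ∈ maximalIdeal A := by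
    intro r hr
    rw [List.mem_ofFn'] at hr
    exact hm ▸ Ideal.subset_span hr
  have hw : RingTheory.Sequence.IsWeaklyRegular A (List.ofFn x) := by
    refine ⟨fun i hi => ?_⟩
    have hi' : i < n := by simpa using hi
    have hJ : Ideal.ofList ((List.ofFn x).take i) = Ideal.span (x '' {j | j.1 < i}) := by
      rw [Ideal.ofList]
      congr 1
      ext r
      simp only [Set.mem_ofPred_eq, List.mem_take_iff_getElem, Set.mem_image, List.length_ofFn,
        List.getElem_ofFn]
      constructor
      · rintro ⟨j, hj, rfl⟩
        exact ⟨⟨j, by omega⟩, show j < i by omega, rfl⟩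
      · rintro ⟨j, hj, rfl⟩
        have : j.1 < i := hj
        exact ⟨j, by omega, rfl⟩
    rw [isSMulRegular_iff_right_eq_zero_of_smul]
    intro m hm0
    obtain ⟨r, rfl⟩ := Submodule.Quotient.mk_surjective _ m
    rw [← Submodule.Quotient.mk_smul, Submodule.Quotient.mk_eq_zero, smul_eq_mul,
      smul_eq_mul, Ideal.mul_top, hJ, List.getElem_ofFn, mul_comm] at hm0
    rw [Submodule.Quotient.mk_eq_zero, smul_eq_mul, Ideal.mul_top, hJ]
    exact hreg _ ⟨i, hi'⟩ (by simp) r hm0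
  have hr := (IsLocalRing.isRegular_iff_isWeaklyRegular_of_subset_maximalIdeal (M := A) hmem).2 hw
  have hd := ringKrullDim_add_length_eq_ringKrullDim_of_isRegular _ hr
  rw [List.length_ofFn] at hd
  have hne : Nontrivial (A ⧸ Ideal.ofList (List.ofFn x)) :=
    Ideal.Quotient.nontrivial_iff.2 fun h => by
      refine (Ideal.IsPrime.ne_top' : maximalIdeal A ≠ ⊤) (top_le_iff.1 (h ▸ Ideal.span_le.2 hmem))
  rw [← hd]
  exact le_add_of_nonneg_left ringKrullDim_nonneg_of_nontrivial

end RegularLocal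

section RegularArtinian

open scoped Pointwise

variable {A : Type} [CommRing A]

/-- A module on which multiplication by `x` is locally nilpotent and has Artinian kernel is
Artinian. -/
theorem isArtinian_of_torsion_of_isArtinian_ker {H : Type} [AddCommGroup H] [Module A H] (x : A)
    (htor : ∀ h : H, ∃ k : ℕ, x ^ k • h = 0) (hker : IsArtinian A (LinearMap.ker (LinearMap.lsmul A H x))) :
    IsArtinian A H := by
  classical
  set K := LinearMap.ker (LinearMap.lsmul A H x) with hK
  have memK : ∀ h, h ∈ K ↔ x • h = 0 := fun h => by simp [hK]
  rw [← monotone_stabilizes_iff_artinian]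
  intro f
  let N : ℕ → Submodule A H := fun i => OrderDual.ofDual (f i)
  have hN : ∀ i j, i ≤ j → N j ≤ N i := fun i j h => f.monotone h
  let L : ℕ → ℕ → Submodule A K := fun k i =>
    Submodule.comap K.subtype ((N i ⊓ LinearMap.ker (LinearMap.lsmul A H (x ^ (k + 1)))).map
      (LinearMap.lsmul A H (x ^ k)))
  have memL : ∀ k i (h : K), h ∈ L k i ↔ ∃ m ∈ N i, x ^ (k + 1) • m = 0 ∧ x ^ k • m = h := by
    intro k i h
    simp [L, and_assoc]
  have hL : ∀ k i k' i', k ≤ k' → i ≤ i' → L k' i' ≤ L k i := by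
    intro k i k' i' hk hi h hh
    rw [memL] at hh ⊢
    obtain ⟨m, hm, h1, h2⟩ := hh
    obtain ⟨c, rfl⟩ := Nat.exists_eq_add_of_le hk
    refine ⟨x ^ c • m, (N i).smul_mem _ (hN _ _ hi hm), ?_, ?_⟩
    · rw [smul_smul, ← pow_add, ← h1]; congr 2; ring
    · rw [smul_smul, ← pow_add, h2]
  obtain ⟨_, ⟨⟨k0, i0⟩, rfl⟩, hmin⟩ := IsArtinian.set_has_minimal
    (Set.range fun q : ℕ × ℕ => L q.1 q.2) (Set.range_nonempty _)
  have hbig : ∀ k i, k0 ≤ k → i0 ≤ i → L k i = L k0 i0 := fun k i hk hi =>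
    ((hL _ _ _ _ hk hi).lt_or_eq).resolve_left (hmin _ ⟨(k, i), rfl⟩)
  have hst : ∀ k, ∃ i, ∀ j, i ≤ j → L k j = L k i := by
    intro k
    obtain ⟨_, ⟨i, rfl⟩, hm⟩ := IsArtinian.set_has_minimal
      (Set.range fun q : ℕ => L k q) (Set.range_nonempty _)
    exact ⟨i, fun j hj => ((hL _ _ _ _ le_rfl hj).lt_or_eq).resolve_left (hm _ ⟨j, rfl⟩)⟩
  choose s hs using hst
  let n := max i0 ((Finset.range k0).sup s)
  have hn : ∀ k j, n ≤ j → L k j = L k n := by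
    intro k j hj
    by_cases hk : k0 ≤ k
    · rw [hbig k j hk ((le_max_left _ _).trans hj), hbig k n hk (le_max_left _ _)]
    · have h1 : s k ≤ n := (Finset.le_sup (f := s) (Finset.mem_range.2 (not_le.1 hk))).trans
        (le_max_right _ _)
      rw [hs k j (h1.trans hj), hs k n h1]
  refine ⟨n, fun j hj => ?_⟩
  have key : ∀ k, ∀ m ∈ N n, x ^ k • m = 0 → m ∈ N j := by
    intro k
    induction k with
    | zero => intro m _ h; simp at h; simp [h]
    | succ k ih =>
      intro m hm h
      have h1 : (⟨x ^ k • m, (memK _).2 (by rw [smul_smul, ← pow_succ', h])⟩ : K) ∈ L k n :=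
        (memL _ _ _).2 ⟨m, hm, h, rfl⟩
      rw [← hn k j hj, memL] at h1
      obtain ⟨m', hm', _, h3⟩ := h1
      have := ih (m - m') ((N n).sub_mem hm (hN _ _ hj hm')) (by rw [smul_sub, h3, sub_self])
      simpa using (N j).add_mem this hm'
  refine congrArg OrderDual.toDual (le_antisymm (a := N n) (b := N j) ?_ (hN _ _ hj))
  intro m hm
  obtain ⟨k, hk⟩ := htor m
  exact key k m hm hk

/-- `rs` is a weakly regular sequence on `E` and `E ⧸ (rs)E` is Artinian. -/
def IsRegularArtinian : List A → ∀ (E : Type) [AddCommGroup E] [Module A E], Prop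
  | [], E, _, _ => IsArtinian A E
  | x :: rs, E, _, _ => IsSMulRegular E x ∧ IsRegularArtinian rs (QuotSMulTop x E)

theorem IsRegularArtinian.of_isWeaklyRegular (rs : List A) :
    ∀ (E : Type) [AddCommGroup E] [Module A E], RingTheory.Sequence.IsWeaklyRegular E rs →
      IsArtinian A (E ⧸ (Ideal.ofList rs • ⊤ : Submodule A E)) → IsRegularArtinian rs E := by
  induction rs with
  | nil =>
    intro E _ _ _ h
    have e : (E ⧸ (Ideal.ofList ([] : List A) • ⊤ : Submodule A E)) ≃ₗ[A] E :=
      Submodule.quotEquivOfEqBot _ (by simp)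
    exact (e.symm).isArtinian_iff.2 h
  | cons x rs ih =>
    intro E _ _ h1 h2
    rw [RingTheory.Sequence.isWeaklyRegular_cons_iff] at h1
    refine ⟨h1.1, ih _ h1.2 ?_⟩
    exact (Submodule.quotOfListConsSMulTopEquivQuotSMulTopInner E x rs).isArtinian_iff.1 h2

theorem IsRegularArtinian.of_ker (rs : List A) (x : A) :
    ∀ (E H : Type) [AddCommGroup E] [Module A E] [AddCommGroup H] [Module A H] (j : E →ₗ[A] H),
      Function.Injective j → (∀ h, x • h = 0 ↔ h ∈ LinearMap.range j) →
      (∀ h : H, ∃ h', x • h' = h) → (∀ h : H, ∃ k : ℕ, x ^ k • h = 0) →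
      IsRegularArtinian rs E → IsRegularArtinian rs H := by
  induction rs with
  | nil =>
    intro E H _ _ _ _ j hj hr hs ht h
    refine isArtinian_of_torsion_of_isArtinian_ker x ht ?_
    have h' : IsArtinian A E := h
    have hk : LinearMap.ker (LinearMap.lsmul A H x) = LinearMap.range j := by
      ext h; rw [← hr]; simp
    rw [hk]
    exact ((LinearEquiv.ofInjective j hj).isArtinian_iff).1 h'
  | cons y rs ih =>
    intro E H _ _ _ _ j hj hr hs ht h
    have hxj : ∀ a, x • j a = 0 := fun a => (hr _).2 ⟨a, rfl⟩
    have hy : ∀ h : H, y • h = 0 → h = 0 := by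
      intro h0 hy
      obtain ⟨k, hk⟩ := ht h0
      induction k generalizing h0 with
      | zero => simpa using hk
      | succ k ihk =>
        have := ihk (x • h0) (by rw [smul_comm, hy, smul_zero]) (by rw [smul_smul, ← pow_succ, hk])
        obtain ⟨a, rfl⟩ := (hr h0).1 this
        rw [← map_smul] at hy
        have := hj (hy.trans (map_zero j).symm)
        rw [h.1.right_eq_zero_of_smul this, map_zero]
    refine ⟨(isSMulRegular_iff_right_eq_zero_of_smul).2 hy, ih (QuotSMulTop y E) (QuotSMulTop y H) (QuotSMulTop.map y j)
      ?_ ?_ ?_ ?_ h.2⟩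
    · rw [injective_iff_map_eq_zero]
      intro a ha
      obtain ⟨a, rfl⟩ := Submodule.Quotient.mk_surjective _ a
      rw [QuotSMulTop.map_apply_mk, Submodule.Quotient.mk_eq_zero,
        Submodule.mem_smul_pointwise_iff_exists] at ha
      obtain ⟨h0, -, h1⟩ := ha
      have h2 : x • h0 = 0 := hy _ (by rw [smul_comm, h1, hxj])
      obtain ⟨b, rfl⟩ := (hr _).1 h2
      rw [← map_smul] at h1
      rw [← hj h1, Submodule.Quotient.mk_eq_zero]
      exact Submodule.smul_mem_pointwise_smul _ _ _ trivial
    · intro h0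
      obtain ⟨h0, rfl⟩ := Submodule.Quotient.mk_surjective _ h0
      constructor
      · intro h1
        rw [← Submodule.Quotient.mk_smul, Submodule.Quotient.mk_eq_zero,
          Submodule.mem_smul_pointwise_iff_exists] at h1
        obtain ⟨h2, -, h1⟩ := h1
        obtain ⟨h3, rfl⟩ := hs h2
        obtain ⟨a, ha⟩ := (hr (h0 - y • h3)).1 (by rw [smul_sub, ← h1, smul_comm, sub_self])
        refine ⟨Submodule.Quotient.mk a, ?_⟩
        rw [QuotSMulTop.map_apply_mk, ha, Submodule.Quotient.eq, Submodule.mem_smul_pointwise_iff_exists]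
        exact ⟨-h3, trivial, by simp⟩
      · rintro ⟨a, ha⟩
        obtain ⟨a, rfl⟩ := Submodule.Quotient.mk_surjective _ a
        rw [← ha, QuotSMulTop.map_apply_mk, ← Submodule.Quotient.mk_smul, hxj,
          Submodule.Quotient.mk_zero]
    · intro h0
      obtain ⟨h0, rfl⟩ := Submodule.Quotient.mk_surjective _ h0
      obtain ⟨h1, rfl⟩ := hs h0
      exact ⟨Submodule.Quotient.mk h1, rfl⟩
    · intro h0
      obtain ⟨h0, rfl⟩ := Submodule.Quotient.mk_surjective _ h0
      obtain ⟨k, hk⟩ := ht h0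
      exact ⟨k, by rw [← Submodule.Quotient.mk_smul, hk, Submodule.Quotient.mk_zero]⟩

/-- The localization `E[1/x]`. -/
abbrev PowLoc (x : A) (E : Type) [AddCommGroup E] [Module A E] : Type :=
  LocalizedModule (Submonoid.powers x) E

/-- The canonical map `E → E[1/x]`. -/
noncomputable abbrev toPowLoc (x : A) (E : Type) [AddCommGroup E] [Module A E] :
    E →ₗ[A] PowLoc x E :=
  LocalizedModule.mkLinearMap (Submonoid.powers x) E

/-- The quotient `E[1/x] ⧸ E`. -/
abbrev LocQuot (x : A) (E : Type) [AddCommGroup E] [Module A E] : Type :=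
  PowLoc x E ⧸ LinearMap.range (toPowLoc x E)

section

variable (x : A) {E : Type} [AddCommGroup E] [Module A E]

/-- Division by `x` on `E[1/x]`. -/
noncomputable def powLocDiv : PowLoc x E →ₗ[A] PowLoc x E :=
  (LocalizedModule.divBy ⟨x, Submonoid.mem_powers x⟩).restrictScalars A

@[simp]
theorem smul_powLocDiv (z : PowLoc x E) : x • powLocDiv x z = z :=
  LocalizedModule.mul_by_divBy ⟨x, Submonoid.mem_powers x⟩ z

@[simp]
theorem powLocDiv_smul (z : PowLoc x E) : powLocDiv x (x • z) = z := by
  rw [map_smul, smul_powLocDiv]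

theorem exists_pow_smul_eq_toPowLoc (z : PowLoc x E) : ∃ (k : ℕ) (e : E), x ^ k • z = toPowLoc x E e := by
  obtain ⟨⟨e, ⟨_, k, rfl⟩⟩, h⟩ := IsLocalizedModule.surj (Submonoid.powers x) (toPowLoc x E) z
  exact ⟨k, e, h⟩

variable {x}

theorem toPowLoc_injective (hx : IsSMulRegular E x) : Function.Injective (toPowLoc x E) := by
  rw [injective_iff_map_eq_zero]
  intro e he
  rw [IsLocalizedModule.eq_zero_iff (Submonoid.powers x)] at he
  obtain ⟨⟨_, k, rfl⟩, h⟩ := he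
  exact (hx.pow k).right_eq_zero_of_smul h

theorem IsRegularArtinian.locQuot {rs : List A} (h : IsRegularArtinian (x :: rs) E) :
    IsRegularArtinian rs (LocQuot x E) := by
  let j0 : E →ₗ[A] LocQuot x E := (Submodule.mkQ _) ∘ₗ powLocDiv x ∘ₗ toPowLoc x E
  have hj0 : ∀ e, j0 e = Submodule.Quotient.mk (powLocDiv x (toPowLoc x E e)) := fun e => rfl
  have hle : x • (⊤ : Submodule A E) ≤ LinearMap.ker j0 := by
    intro e he
    rw [Submodule.mem_smul_pointwise_iff_exists] at he
    obtain ⟨e, -, rfl⟩ := he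
    rw [LinearMap.mem_ker, hj0, map_smul, powLocDiv_smul, Submodule.Quotient.mk_eq_zero]
    exact ⟨e, rfl⟩
  refine IsRegularArtinian.of_ker rs x (QuotSMulTop x E) (LocQuot x E)
    (Submodule.liftQ _ j0 hle) ?_ ?_ ?_ ?_ h.2
  · rw [injective_iff_map_eq_zero]
    intro a ha
    obtain ⟨a, rfl⟩ := Submodule.Quotient.mk_surjective _ a
    rw [Submodule.liftQ_apply, hj0, Submodule.Quotient.mk_eq_zero] at ha
    obtain ⟨b, hb⟩ := ha
    have : x • toPowLoc x E b = toPowLoc x E a := by rw [hb, smul_powLocDiv]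
    rw [← map_smul] at this
    rw [← toPowLoc_injective h.1 this, Submodule.Quotient.mk_eq_zero]
    exact Submodule.smul_mem_pointwise_smul _ _ _ trivial
  · intro z
    obtain ⟨z, rfl⟩ := Submodule.Quotient.mk_surjective _ z
    constructor
    · intro hz
      rw [← Submodule.Quotient.mk_smul, Submodule.Quotient.mk_eq_zero] at hz
      obtain ⟨e, he⟩ := hz
      refine ⟨Submodule.Quotient.mk e, ?_⟩
      rw [Submodule.liftQ_apply, hj0, he, powLocDiv_smul]
    · rintro ⟨a, ha⟩
      obtain ⟨a, rfl⟩ := Submodule.Quotient.mk_surjective _ a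
      rw [← ha, Submodule.liftQ_apply, hj0, ← Submodule.Quotient.mk_smul, smul_powLocDiv,
        Submodule.Quotient.mk_eq_zero]
      exact ⟨a, rfl⟩
  · intro z
    obtain ⟨z, rfl⟩ := Submodule.Quotient.mk_surjective _ z
    exact ⟨Submodule.Quotient.mk (powLocDiv x z), by
      rw [← Submodule.Quotient.mk_smul, smul_powLocDiv]⟩
  · intro z
    obtain ⟨z, rfl⟩ := Submodule.Quotient.mk_surjective _ z
    obtain ⟨k, e, h⟩ := exists_pow_smul_eq_toPowLoc x z
    refine ⟨k, ?_⟩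
    rw [← Submodule.Quotient.mk_smul, h, Submodule.Quotient.mk_eq_zero]
    exact ⟨e, rfl⟩

end

end RegularArtinian

section AlmostFlat

open TensorProduct

variable {A : Type} [CommRing A]

/-- Every map from a finite module to `Y` factors through a finite free module after
multiplication by any element of a suitable power of `m`. -/
def AlmostFlat (m : Ideal A) (Y : Type) [AddCommGroup Y] [Module A Y] : Prop :=
  ∀ (M : Type) [AddCommGroup M] [Module A M] [Module.Finite A M] (ψ : M →ₗ[A] Y),
    ∃ N : ℕ, ∀ s ∈ m ^ N, ∃ (r : ℕ) (α : M →ₗ[A] (Fin r →₀ A)) (β : (Fin r →₀ A) →ₗ[A] Y),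
      s • ψ = β ∘ₗ α

variable {m : Ideal A} {Y : Type} [AddCommGroup Y] [Module A Y]

theorem exists_lift_to_ker {G M F P : Type} [AddCommGroup G] [Module A G] [AddCommGroup M]
    [Module A M] [AddCommGroup F] [Module A F] [AddCommGroup P] [Module A P] [Module.Projective A P]
    (π : F →ₗ[A] Y) (hπ : Function.Surjective π) (q : G →ₗ[A] M) (ψ : M →ₗ[A] Y) (χ : G →ₗ[A] F)
    (hχ : π ∘ₗ χ = ψ ∘ₗ q) (s : A) (α : M →ₗ[A] P) (β : P →ₗ[A] Y) (h : s • ψ = β ∘ₗ α) :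
    ∃ δ : G →ₗ[A] LinearMap.ker π, ∀ g, q g = 0 → (δ g : F) = s • χ g := by
  obtain ⟨β', hβ'⟩ := Module.projective_lifting_property π β hπ
  refine ⟨LinearMap.codRestrict _ (s • χ - β' ∘ₗ α ∘ₗ q) fun g => ?_, fun g hg => by simp [hg]⟩
  have h1 : π (χ g) = ψ (q g) := LinearMap.congr_fun hχ g
  have h2 : s • ψ (q g) = β (α (q g)) := LinearMap.congr_fun h (q g)
  have h3 : π (β' (α (q g))) = β (α (q g)) := LinearMap.congr_fun hβ' (α (q g))
  simp [h1, h2, h3]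

theorem finite_of_isArtinian_of_pow_smul_eq_zero [hm : m.IsMaximal] (N : ℕ) :
    ∀ (H : Type) [AddCommGroup H] [Module A H] [IsArtinian A H],
      (∀ s ∈ m ^ N, ∀ h : H, s • h = 0) → Module.Finite A H := by
  induction N with
  | zero =>
    intro H _ _ _ h
    have : Subsingleton H := subsingleton_of_forall_eq 0 fun y => by
      simpa using h 1 (by simp) y
    infer_instance
  | succ N ih =>
    intro H _ _ _ h
    have h1 : Module.Finite A (m • ⊤ : Submodule A H) := by
      refine ih _ fun s hs => ?_
      rintro ⟨y, hy⟩
      ext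
      change s • y = 0
      induction hy using Submodule.smul_induction_on' with
      | smul a ha y _ => rw [smul_smul]; exact h _ (by rw [pow_succ]; exact Ideal.mul_mem_mul hs ha) _
      | add y _ z _ hy hz => rw [smul_add, hy, hz, add_zero]
    have h2 : Module.IsTorsionBySet A (H ⧸ (m • ⊤ : Submodule A H)) (m : Set A) := by
      rintro y ⟨s, hs⟩
      obtain ⟨y, rfl⟩ := Submodule.Quotient.mk_surjective _ y
      change s • _ = _
      rw [← Submodule.Quotient.mk_smul, Submodule.Quotient.mk_eq_zero]
      exact Submodule.smul_mem_smul hs trivial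
    let _ : Field (A ⧸ m) := Ideal.Quotient.field m
    let _ : Module (A ⧸ m) (H ⧸ (m • ⊤ : Submodule A H)) := h2.module
    have h3 : IsSemisimpleModule A (H ⧸ (m • ⊤ : Submodule A H)) :=
      h2.isSemisimpleModule_iff.1 inferInstance
    have h4 : Module.Finite A (H ⧸ (m • ⊤ : Submodule A H)) :=
      (IsSemisimpleModule.finite_tfae.out 0 2 : _ ↔ IsArtinian A _).2 inferInstance
    exact Module.Finite.of_submodule_quotient (m • ⊤ : Submodule A H)

variable [IsNoetherianRing A]

theorem AlmostFlat.ker (hY : AlmostFlat m Y) {F : Type} [AddCommGroup F] [Module A F]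
    [Module.Free A F] (π : F →ₗ[A] Y) (hπ : Function.Surjective π) :
    AlmostFlat m (LinearMap.ker π) := by
  intro D _ _ _ φ
  have : Module.FinitePresentation A D := Module.finitePresentation_of_finite A D
  obtain ⟨r, μ, ε, hε⟩ := Module.Flat.exists_factorization_of_finitePresentation
    ((LinearMap.ker π).subtype ∘ₗ φ)
  let C := (Fin r →₀ A) ⧸ LinearMap.range μ
  let ψ : C →ₗ[A] Y := Submodule.liftQ _ (π ∘ₗ ε) (by
    rintro _ ⟨d, rfl⟩
    have := LinearMap.congr_fun hε d
    simp only [LinearMap.comp_apply] at this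
    simp [← this])
  obtain ⟨N, hN⟩ := hY C ψ
  refine ⟨N, fun s hs => ?_⟩
  obtain ⟨k, α, β, h⟩ := hN s hs
  obtain ⟨δ, hδ⟩ := exists_lift_to_ker π hπ (Submodule.mkQ _) ψ ε (by ext; rfl) s α β h
  refine ⟨r, μ, δ, ?_⟩
  ext d
  have h1 := hδ (μ d) (by simp)
  have h2 := LinearMap.congr_fun hε d
  simp only [LinearMap.comp_apply] at h2
  simp [h1, ← h2]

theorem Submodule.FG.map_comap_of_ker_le {T U V : Type} [AddCommGroup T] [Module A T]
    [AddCommGroup U] [Module A U] [AddCommGroup V] [Module A V] {W : Submodule A U} (hW : W.FG)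
    (f : T →ₗ[A] U) (g : T →ₗ[A] V) (h : LinearMap.ker f ≤ LinearMap.ker g) :
    ((W.comap f).map g).FG := by
  have : IsNoetherian A W := isNoetherian_of_fg_of_noetherian W hW
  let f' := f.restrict (p := W.comap f) (q := W) fun _ h => h
  have hle : LinearMap.ker f' ≤ LinearMap.ker (g.domRestrict (W.comap f)) := by
    intro x hx
    have h1 : f x = 0 := congrArg Subtype.val (LinearMap.mem_ker.1 hx)
    exact h (LinearMap.mem_ker.2 h1)
  have h1 : Module.Finite A (_ ⧸ LinearMap.ker f') :=
    Module.Finite.equiv f'.quotKerEquivRange.symm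
  have h2 : (W.comap f).map g = LinearMap.range (Submodule.liftQ _ _ hle) := by
    rw [Submodule.range_liftQ, LinearMap.range_domRestrict]
  rw [h2]
  exact Module.Finite.iff_fg.1 inferInstance

theorem Submodule.FG.exists_fg_of_relation {U V X P Q : Type} [AddCommGroup U] [Module A U]
    [AddCommGroup V] [Module A V] [AddCommGroup X] [Module A X] [AddCommGroup P] [Module A P]
    [AddCommGroup Q] [Module A Q] {W : Submodule A P} (hW : W.FG) (a : U →ₗ[A] X) (b : V →ₗ[A] X)
    (f : U →ₗ[A] P) (g : V →ₗ[A] Q) (h : ∀ u v, a u = b v → f u = 0 → g v = 0) :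
    ∃ W' : Submodule A Q, W'.FG ∧ ∀ u v, a u = b v → f u ∈ W → g v ∈ W' := by
  let T : Submodule A (U × V) :=
    LinearMap.eqLocus (a ∘ₗ LinearMap.fst A U V) (b ∘ₗ LinearMap.snd A U V)
  refine ⟨(W.comap (f ∘ₗ LinearMap.fst A U V ∘ₗ T.subtype)).map
    (g ∘ₗ LinearMap.snd A U V ∘ₗ T.subtype), hW.map_comap_of_ker_le _ _ ?_, ?_⟩
  · rintro ⟨⟨u, v⟩, ht⟩ h0
    exact h u v ht h0
  · intro u v huv hu
    exact ⟨⟨(u, v), huv⟩, hu, rfl⟩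

/-- Elements of `M ⊗ E` which are killed, up to multiplication by a power of `m`, by maps through
which multiples of `ψ` factor, have image in a fixed finite submodule, provided this is so for
elements killed by a power of `m`. -/
theorem exists_fg_of_factorization (E : Type) [AddCommGroup E] [Module A E]
    (hE : ∀ (M : Type) [AddCommGroup M] [Module A M] [Module.Finite A M] (ψ : M →ₗ[A] Y) (N : ℕ),
      ∃ W : Submodule A (Y ⊗[A] E), W.FG ∧ ∀ z : M ⊗[A] E, (∀ s ∈ m ^ N, s • z = 0) →
        ψ.rTensor E z ∈ W)
    (M : Type) [AddCommGroup M] [Module A M] [Module.Finite A M] (ψ : M →ₗ[A] Y) (N : ℕ)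
    (T : Set (M ⊗[A] E))
    (hT : ∀ s ∈ m ^ N, ∃ (r : ℕ) (α : M →ₗ[A] (Fin r →₀ A)) (β : (Fin r →₀ A) →ₗ[A] Y),
      s • ψ = β ∘ₗ α ∧ ∀ z ∈ T, α.rTensor E z = 0) :
    ∃ W : Submodule A (Y ⊗[A] E), W.FG ∧ ∀ z ∈ T, ψ.rTensor E z ∈ W := by
  have h1 : ∀ s : A, ∃ P : Submodule A Y, P.FG ∧ (s ∈ m ^ N → ∃ (r : ℕ) (α : M →ₗ[A] (Fin r →₀ A))
      (β : (Fin r →₀ A) →ₗ[A] Y),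
      s • ψ = β ∘ₗ α ∧ (∀ z ∈ T, α.rTensor E z = 0) ∧ LinearMap.range β ≤ P) := by
    intro s
    by_cases hs : s ∈ m ^ N
    · obtain ⟨r, α, β, h, h'⟩ := hT s hs
      exact ⟨LinearMap.range β, Module.Finite.iff_fg.1 inferInstance,
        fun _ => ⟨r, α, β, h, h', le_rfl⟩⟩
    · exact ⟨⊥, Submodule.fg_bot, fun h => absurd h hs⟩
  choose P hP hP' using h1
  obtain ⟨S, hS⟩ := (inferInstance : IsNoetherianRing A).noetherian (m ^ N)
  let Q : Submodule A Y := LinearMap.range ψ ⊔ S.sup P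
  have hQ : Q.FG := Submodule.FG.sup (Module.Finite.iff_fg.1 inferInstance)
    (Submodule.fg_finset_sup _ _ fun s _ => hP s)
  have : Module.Finite A Q := Module.Finite.iff_fg.2 hQ
  let ψ' : M →ₗ[A] Q := ψ.codRestrict Q fun y => (le_sup_left : _ ≤ Q) ⟨y, rfl⟩
  obtain ⟨W, hW, hW'⟩ := hE Q Q.subtype N
  refine ⟨W, hW, fun z hz => ?_⟩
  have h2 : ψ.rTensor E z = Q.subtype.rTensor E (ψ'.rTensor E z) := by
    rw [← LinearMap.rTensor_comp_apply]; rfl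
  rw [h2]
  refine hW' _ fun s hs => ?_
  rw [← hS] at hs
  induction hs using Submodule.span_induction with
  | zero => simp
  | add a b _ _ ha hb => rw [add_smul, ha, hb, add_zero]
  | smul a b _ hb => rw [smul_eq_mul, mul_smul, hb, smul_zero]
  | mem s hs =>
    have hsm : s ∈ m ^ N := by rw [← hS]; exact Submodule.subset_span hs
    obtain ⟨r, α, β, h, h', h''⟩ := hP' s hsm
    let β' : (Fin r →₀ A) →ₗ[A] Q := β.codRestrict Q fun y =>
      (le_sup_right : _ ≤ Q) ((Finset.le_sup (f := P) hs) (h'' ⟨y, rfl⟩))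
    have h3 : s • ψ' = β' ∘ₗ α := by
      ext y
      exact LinearMap.congr_fun h y
    rw [← LinearMap.smul_apply, ← LinearMap.rTensor_smul, h3, LinearMap.rTensor_comp_apply, h' z hz,
      map_zero]

theorem exists_fg_of_diagram {J : Ideal A} {x : A} {N : ℕ} (hxm : x ^ N ∈ J) {E P Q : Type} [AddCommGroup E]
    [Module A E] [AddCommGroup P] [Module A P] [AddCommGroup Q] [Module A Q] (ι : E →ₗ[A] P)
    (θ : P →ₗ[A] Q) (hι0 : Function.Injective ι) (hιθ : Function.Exact ι θ)
    (hθ : Function.Surjective θ) (D : P →ₗ[A] P) (hD : ∀ y, D (x • y) = y)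
    {F G K Z M : Type} [AddCommGroup F] [Module A F] [Module.Flat A F] [AddCommGroup G] [Module A G]
    [AddCommGroup K] [Module A K] [AddCommGroup Z] [Module A Z] [AddCommGroup M] [Module A M]
    (kp : K →ₗ[A] F) (π : F →ₗ[A] Y) (hkpπ : Function.Exact kp π) (hπ : Function.Surjective π)
    (k : Z →ₗ[A] G) (q : G →ₗ[A] M) (hkq : Function.Exact k q) (hq : Function.Surjective q)
    (χ : G →ₗ[A] F) (χZ : Z →ₗ[A] K) (ψ : M →ₗ[A] Y) (hχ : π ∘ₗ χ = ψ ∘ₗ q)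
    (hχZ : kp ∘ₗ χZ = χ ∘ₗ k) {W : Submodule A (K ⊗[A] Q)} (hW : W.FG)
    (hW' : ∀ z, k.rTensor Q z = 0 → χZ.rTensor Q z ∈ W) :
    ∃ W : Submodule A (Y ⊗[A] E), W.FG ∧ ∀ z : M ⊗[A] E, (∀ s ∈ J, s • z = 0) →
      ψ.rTensor E z ∈ W := by
  have hι : Function.Injective (ι.lTensor F) :=
    Module.Flat.lTensor_preserves_injective_linearMap _ hι0
  obtain ⟨W₂, hW₂, hWW⟩ := hW.exists_fg_of_relation (kp.rTensor P) (ι.lTensor F)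
    (θ.lTensor K) (π.rTensor E) (by
      intro w g ht h1
      obtain ⟨e, rfl⟩ := (lTensor_exact K hιθ hθ w).1 h1
      have h2 : kp.rTensor P (ι.lTensor K e) = ι.lTensor F (kp.rTensor E e) := by
        rw [← LinearMap.comp_apply, ← LinearMap.comp_apply, LinearMap.rTensor_comp_lTensor,
          LinearMap.lTensor_comp_rTensor]
      rw [← hι (h2.symm.trans ht)]
      exact (rTensor_exact E hkpπ hπ _).2 ⟨_, rfl⟩)
  refine ⟨W₂, hW₂, fun z hz => ?_⟩
  have hz1 : ι.lTensor M z = 0 := by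
    have h1 : x ^ N • ι.lTensor M z = 0 := by
      rw [← map_smul, hz _ hxm, map_zero]
    have h2 : ∀ (n : ℕ) (y : M ⊗[A] P), x ^ n • y = 0 → y = 0 := by
      have h3 : ∀ y : M ⊗[A] P, x • y = 0 → y = 0 := by
        intro y hy
        have h4 : D.lTensor M (x • y) = y := by
          rw [← LinearMap.lsmul_apply, ← LinearMap.comp_apply]
          have : D.lTensor M ∘ₗ LinearMap.lsmul A (M ⊗[A] P) x =
              LinearMap.id := by
            ext a b
            simp [← TensorProduct.tmul_smul, hD]
          rw [this]; rfl
        rw [← h4, hy, map_zero]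
      intro n
      induction n with
      | zero => intro y hy; simpa using hy
      | succ n ihn => intro y hy; exact h3 _ (ihn _ (by rw [smul_smul, ← pow_succ, hy]))
    exact h2 N _ h1
  obtain ⟨g, rfl⟩ := LinearMap.rTensor_surjective E hq z
  have hg : q.rTensor P (ι.lTensor G g) = 0 := by
    rw [← hz1, ← LinearMap.comp_apply, ← LinearMap.comp_apply, LinearMap.rTensor_comp_lTensor,
      LinearMap.lTensor_comp_rTensor]
  obtain ⟨w, hw⟩ := (rTensor_exact P hkq hq _).1 hg
  have hy : k.rTensor Q (θ.lTensor Z w) = 0 := by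
    have h1 : k.rTensor Q (θ.lTensor Z w) = θ.lTensor G (k.rTensor P w) := by
      rw [← LinearMap.comp_apply, ← LinearMap.comp_apply, LinearMap.rTensor_comp_lTensor,
        LinearMap.lTensor_comp_rTensor]
    rw [h1, hw]
    exact (lTensor_exact _ hιθ hθ _).2 ⟨_, rfl⟩
  have hyW := hW' _ hy
  have ht : kp.rTensor P (χZ.rTensor P w) = ι.lTensor F (χ.rTensor E g) := by
    rw [← LinearMap.rTensor_comp_apply, hχZ, LinearMap.rTensor_comp_apply, hw,
      ← LinearMap.comp_apply, ← LinearMap.comp_apply, LinearMap.rTensor_comp_lTensor,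
      LinearMap.lTensor_comp_rTensor]
  have h4 := hWW _ _ ht (by
    convert hyW using 1
    rw [← LinearMap.comp_apply, ← LinearMap.comp_apply, LinearMap.rTensor_comp_lTensor,
      LinearMap.lTensor_comp_rTensor])
  rwa [← LinearMap.rTensor_comp_apply, hχ, LinearMap.rTensor_comp_apply] at h4

theorem AlmostFlat.exists_kernel (hY : AlmostFlat m Y) {F G M : Type} [AddCommGroup F] [Module A F]
    [Module.Free A F] [AddCommGroup G] [Module A G] [AddCommGroup M] [Module A M]
    [Module.Finite A M] (π : F →ₗ[A] Y) (hπ : Function.Surjective π) (q : G →ₗ[A] M)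
    (ψ : M →ₗ[A] Y) (χ : G →ₗ[A] F) (hχ : π ∘ₗ χ = ψ ∘ₗ q) :
    ∃ (K : Type) (_ : AddCommGroup K) (_ : Module A K) (kp : K →ₗ[A] F)
      (χZ : LinearMap.ker q →ₗ[A] K), AlmostFlat m K ∧ Function.Exact kp π ∧
      kp ∘ₗ χZ = χ ∘ₗ (LinearMap.ker q).subtype ∧
      ∃ N : ℕ, ∀ s ∈ m ^ N, ∃ δ : G →ₗ[A] K, s • χZ = δ ∘ₗ (LinearMap.ker q).subtype := by
  have hmem : ∀ z ∈ LinearMap.ker q, χ z ∈ LinearMap.ker π := fun z hz => by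
    have := LinearMap.congr_fun hχ z
    simp only [LinearMap.comp_apply] at this
    rwa [LinearMap.mem_ker.1 hz, map_zero] at this
  refine ⟨LinearMap.ker π, inferInstance, inferInstance, (LinearMap.ker π).subtype,
    χ.restrict hmem, hY.ker π hπ, fun y => by simp, rfl, ?_⟩
  obtain ⟨N, hN⟩ := hY M ψ
  refine ⟨N, fun s hs => ?_⟩
  obtain ⟨l, α, β, h⟩ := hN s hs
  obtain ⟨δ, hδ⟩ := exists_lift_to_ker π hπ q ψ χ hχ s α β h
  exact ⟨δ, by ext z : 2; exact (hδ z z.2).symm⟩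

theorem exists_fg_of_exact {x : A} (hxm : x ∈ m) {E P Q : Type} [AddCommGroup E] [Module A E]
    [AddCommGroup P] [Module A P] [AddCommGroup Q] [Module A Q] (ι : E →ₗ[A] P) (θ : P →ₗ[A] Q)
    (hι0 : Function.Injective ι) (hιθ : Function.Exact ι θ) (hθ : Function.Surjective θ)
    (D : P →ₗ[A] P) (hD : ∀ y, D (x • y) = y)
    (hQ : ∀ (Y : Type) [AddCommGroup Y] [Module A Y], AlmostFlat m Y →
      ∀ (M : Type) [AddCommGroup M] [Module A M] [Module.Finite A M] (ψ : M →ₗ[A] Y) (N : ℕ),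
        ∃ W : Submodule A (Y ⊗[A] Q), W.FG ∧ ∀ z : M ⊗[A] Q, (∀ s ∈ m ^ N, s • z = 0) →
          ψ.rTensor Q z ∈ W)
    (hY : AlmostFlat m Y) (M : Type) [AddCommGroup M] [Module A M] [Module.Finite A M]
    (ψ : M →ₗ[A] Y) (N : ℕ) :
    ∃ W : Submodule A (Y ⊗[A] E), W.FG ∧ ∀ z : M ⊗[A] E, (∀ s ∈ m ^ N, s • z = 0) →
      ψ.rTensor E z ∈ W := by
  obtain ⟨r, q, hq⟩ := Module.Finite.exists_fin' A M
  have hπ := Finsupp.linearCombination_id_surjective A Y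
  obtain ⟨χ, hχ⟩ := Module.projective_lifting_property _ (ψ ∘ₗ q) hπ
  obtain ⟨K, _, _, kp, χZ, hK, hkpπ, hχZ, N', hN'⟩ := hY.exists_kernel _ hπ q ψ χ hχ
  obtain ⟨W, hW, hW'⟩ := exists_fg_of_factorization Q (hQ K hK) _ χZ N'
    {z | (LinearMap.ker q).subtype.rTensor Q z = 0} (by
      intro s hs
      obtain ⟨δ, hδ⟩ := hN' s hs
      let e := (Finsupp.linearEquivFunOnFinite A A (Fin r)).symm
      refine ⟨r, e.toLinearMap ∘ₗ (LinearMap.ker q).subtype, δ ∘ₗ e.symm.toLinearMap, ?_, ?_⟩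
      · rw [hδ]
        ext z : 1
        simp
      · intro z hz
        rw [LinearMap.rTensor_comp_apply, hz, map_zero])
  exact exists_fg_of_diagram (Ideal.pow_mem_pow hxm N) ι θ hι0 hιθ hθ D hD kp _ hkpπ hπ _ q
    (LinearMap.exact_subtype_ker_map q) hq χ χZ ψ hχ hχZ hW hW'

theorem exists_fg_of_isRegularArtinian [hm : m.IsMaximal] (rs : List A) : (∀ x ∈ rs, x ∈ m) →
    ∀ (E : Type) [AddCommGroup E] [Module A E], IsRegularArtinian rs E →
    ∀ (Y : Type) [AddCommGroup Y] [Module A Y], AlmostFlat m Y →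
    ∀ (M : Type) [AddCommGroup M] [Module A M] [Module.Finite A M] (ψ : M →ₗ[A] Y) (N : ℕ),
      ∃ W : Submodule A (Y ⊗[A] E), W.FG ∧ ∀ z : M ⊗[A] E, (∀ s ∈ m ^ N, s • z = 0) →
        ψ.rTensor E z ∈ W := by
  induction rs with
  | nil =>
    intro _ E _ _ hE Y _ _ hY M _ _ _ ψ N
    have hE' : IsArtinian A E := hE
    have hME : IsArtinian A (M ⊗[A] E) := by
      obtain ⟨r, q, hq⟩ := Module.Finite.exists_fin' A M
      have h1 : IsArtinian A ((Fin r → A) ⊗[A] E) :=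
        ((TensorProduct.comm A (Fin r → A) E).trans
            (TensorProduct.piScalarRight A A E (Fin r))).symm.isArtinian_iff.1 inferInstance
      exact isArtinian_of_surjective _ (q.rTensor E) (LinearMap.rTensor_surjective E hq)
    let K : Submodule A (M ⊗[A] E) := Submodule.torsionBySet A (M ⊗[A] E) (m ^ N : Ideal A)
    have hK : K.FG := by
      refine Module.Finite.iff_fg.1 (finite_of_isArtinian_of_pow_smul_eq_zero (m := m) N K ?_)
      rintro s hs ⟨y, hy⟩
      ext
      exact (Submodule.mem_torsionBySet_iff _ _).1 hy ⟨s, hs⟩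
    refine ⟨K.map (ψ.rTensor E), hK.map _, fun z hz => ⟨z, ?_, rfl⟩⟩
    simpa [K] using hz
  | cons x rs ih =>
    intro hrs E _ _ hE Y _ _ hY M _ _ _ ψ N
    refine exists_fg_of_exact (hrs x (by simp)) (toPowLoc x E) (Submodule.mkQ _)
      (toPowLoc_injective hE.1) (LinearMap.exact_map_mkQ_range _) (Submodule.mkQ_surjective _)
      (powLocDiv x) (powLocDiv_smul x) ?_ hY M ψ N
    exact ih (fun y hy => hrs y (by simp [hy])) (LocQuot x E) hE.locQuot

end AlmostFlat

section DenominatorModule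

variable {A L : Type} [CommRing A] [Field L] [Algebra A L]

/-- The product in `L` of the elements of a list. -/
def listProd (L : Type) [Field L] [Algebra A L] (xs : List A) : L := (xs.map (algebraMap A L)).prod

/-- The span over the integral closure of the `n`-th powers of the elements of a list. -/
def powSpan (L : Type) [Field L] [Algebra A L] (xs : List A) (n : ℕ) :
    Submodule (integralClosure A L) L :=
  Submodule.span _ ((fun x => algebraMap A L x ^ n) '' {x | x ∈ xs})

theorem listProd_cons (x : A) (xs : List A) :
    listProd L (x :: xs) = algebraMap A L x * listProd L xs := by
  simp [listProd]

theorem exists_listProd_eq_mul {xs : List A} {x : A} (hx : x ∈ xs) :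
    ∃ d : A, listProd L xs = algebraMap A L x * algebraMap A L d := by
  induction xs with
  | nil => simp at hx
  | cons y xs ih =>
    rw [listProd_cons]
    rcases List.mem_cons.1 hx with rfl | h
    · exact ⟨xs.prod, by simp [listProd, map_list_prod]⟩
    · obtain ⟨d, hd⟩ := ih h
      exact ⟨y * d, by rw [hd, map_mul]; ring⟩

theorem listProd_eq_algebraMap (xs : List A) : listProd L xs = algebraMap A L xs.prod := by
  simp [listProd, map_list_prod]

theorem pow_mul_mem_powSpan {xs : List A} (k n : ℕ) {a : L} (ha : a ∈ powSpan L xs n) :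
    listProd L xs ^ k * a ∈ powSpan L xs (n + k) := by
  unfold powSpan at ha
  induction ha using Submodule.span_induction with
  | mem a h =>
    obtain ⟨x, hx, rfl⟩ := h
    obtain ⟨d, hd⟩ := exists_listProd_eq_mul (L := L) hx
    have : listProd L xs ^ k * algebraMap A L x ^ n =
        (algebraMap A (integralClosure A L) (d ^ k)) • algebraMap A L x ^ (n + k) := by
      rw [algebraMap_smul, Algebra.smul_def, hd, map_pow]; ring
    exact this ▸ Submodule.smul_mem _ _ (Submodule.subset_span ⟨x, hx, rfl⟩)
  | zero => simp
  | add a b _ _ ha hb => rw [mul_add]; exact add_mem ha hb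
  | smul c a _ ha => rw [mul_smul_comm]; exact Submodule.smul_mem _ _ ha

/-- The elements `a` of `L` such that `P ^ n * a` lies in the span of the `n`-th powers of the
elements of `xs` for some `n`, where `P` is the product of `xs`. -/
def denom (L : Type) [Field L] [Algebra A L] (xs : List A) : Submodule (integralClosure A L) L where
  carrier := {a | ∃ n, listProd L xs ^ n * a ∈ powSpan L xs n}
  zero_mem' := ⟨0, by simp⟩
  add_mem' := by
    rintro a b ⟨n, hn⟩ ⟨k, hk⟩
    refine ⟨n + k, ?_⟩
    have h1 := pow_mul_mem_powSpan k n hn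
    have h2 := pow_mul_mem_powSpan n k hk
    rw [add_comm k n] at h2
    convert add_mem h1 h2 using 1
    ring
  smul_mem' := by
    rintro c a ⟨n, hn⟩
    exact ⟨n, by rw [mul_smul_comm]; exact Submodule.smul_mem _ _ hn⟩

theorem mem_denom {xs : List A} {a : L} :
    a ∈ denom L xs ↔ ∃ n, listProd L xs ^ n * a ∈ powSpan L xs n := Iff.rfl

theorem coe_mem_denom {xs : List A} (hxs : xs ≠ []) (y : integralClosure A L) :
    (y : L) ∈ denom L xs := by
  obtain ⟨x, xs, rfl⟩ := List.exists_cons_of_ne_nil hxs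
  refine ⟨0, ?_⟩
  have : (y : L) = y • algebraMap A L x ^ 0 := by simp [Algebra.smul_def]
  rw [pow_zero, one_mul, this]
  exact Submodule.smul_mem _ _ (Submodule.subset_span ⟨x, by simp, rfl⟩)

theorem powSpan_cons_of_mem {x : A} {xs : List A} (n : ℕ) : powSpan L xs n ≤ powSpan L (x :: xs) n :=
  Submodule.span_mono (Set.image_mono fun a ha => List.mem_cons_of_mem _ ha)

theorem mem_denom_cons_of_pow_smul_mem {x : A} {xs : List A} (hx : algebraMap A L x ≠ 0) (a : L) (k : ℕ)
    (h : algebraMap A L x ^ k * a ∈ denom L xs) : a ∈ denom L (x :: xs) := by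
  obtain ⟨n, hn⟩ := h
  have h1 := pow_mul_mem_powSpan k n hn
  have h2 := powSpan_cons_of_mem (x := x) _ h1
  refine ⟨n + k, ?_⟩
  have h3 := Submodule.smul_mem _ (algebraMap A (integralClosure A L) (x ^ n)) h2
  rw [algebraMap_smul, Algebra.smul_def, map_pow] at h3
  convert h3 using 1
  rw [listProd_cons]; ring

end DenominatorModule

section DenominatorMap

variable {A L : Type} [CommRing A] [Field L] [Algebra A L]

/-- The elements of `L` that land in `denom L xs` after multiplication by a power of `x`. -/
def denomLoc (x : A) (V : Submodule (integralClosure A L) L) : Submodule (integralClosure A L) L where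
  carrier := {a | ∃ k, algebraMap A L x ^ k * a ∈ V}
  zero_mem' := ⟨0, by simp⟩
  add_mem' := by
    rintro a b ⟨n, hn⟩ ⟨k, hk⟩
    refine ⟨n + k, ?_⟩
    have h1 := V.smul_mem (algebraMap A (integralClosure A L) (x ^ k)) hn
    have h2 := V.smul_mem (algebraMap A (integralClosure A L) (x ^ n)) hk
    rw [algebraMap_smul, Algebra.smul_def, map_pow] at h1 h2
    convert add_mem h1 h2 using 1
    ring
  smul_mem' := by
    rintro c a ⟨n, hn⟩
    exact ⟨n, by rw [mul_smul_comm]; exact V.smul_mem _ hn⟩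

theorem le_denomLoc (x : A) (V : Submodule (integralClosure A L) L) : V ≤ denomLoc x V :=
  fun a ha => ⟨0, by simpa using ha⟩

theorem bijective_smul_denomLoc {x : A} (hx : algebraMap A L x ≠ 0)
    (V : Submodule (integralClosure A L) L) (s : Submonoid.powers x) :
    IsUnit (algebraMap A (Module.End A (L ⧸ denomLoc x V)) s) := by
  obtain ⟨_, k, rfl⟩ := s
  have hk : algebraMap A L x ^ k ≠ 0 := pow_ne_zero _ hx
  rw [Module.End.isUnit_iff]
  constructor
  · rw [injective_iff_map_eq_zero]
    intro z hz
    obtain ⟨a, rfl⟩ := Submodule.Quotient.mk_surjective _ z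
    rw [Module.algebraMap_end_apply, ← Submodule.Quotient.mk_smul, Submodule.Quotient.mk_eq_zero] at hz
    obtain ⟨n, hn⟩ := hz
    rw [Submodule.Quotient.mk_eq_zero]
    refine ⟨n + k, ?_⟩
    rw [Algebra.smul_def, map_pow, ← mul_assoc, ← pow_add] at hn
    exact hn
  · intro z
    obtain ⟨a, rfl⟩ := Submodule.Quotient.mk_surjective _ z
    refine ⟨Submodule.Quotient.mk ((algebraMap A L x ^ k)⁻¹ * a), ?_⟩
    rw [Module.algebraMap_end_apply, ← Submodule.Quotient.mk_smul, Algebra.smul_def]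
    simp only [map_pow]
    rw [mul_inv_cancel_left₀ hk]

theorem exists_lift_powLoc {x : A} (hx : algebraMap A L x ≠ 0)
    (V : Submodule (integralClosure A L) L) {E : Type} [AddCommGroup E] [Module A E]
    (ρ : E →ₗ[A] L ⧸ V) : ∃ σ : PowLoc x E →ₗ[A] L ⧸ denomLoc x V, ∀ (z : PowLoc x E) (k : ℕ) (e : E) (a : L),
      x ^ k • z = toPowLoc x E e → ρ e = Submodule.Quotient.mk a →
        σ z = Submodule.Quotient.mk ((algebraMap A L x ^ k)⁻¹ * a) := by
  let g : E →ₗ[A] L ⧸ denomLoc x V := ((Submodule.factor (le_denomLoc x V)).restrictScalars A) ∘ₗ ρ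
  refine ⟨IsLocalizedModule.lift (Submonoid.powers x) (toPowLoc x E) g (bijective_smul_denomLoc hx V), ?_⟩
  intro z k e a h1 h2
  have h3 := IsLocalizedModule.lift_apply (Submonoid.powers x) (toPowLoc x E) g (bijective_smul_denomLoc hx V) e
  rw [← h1, map_smul] at h3
  have h4 : g e = Submodule.Quotient.mk a := by
    change (Submodule.factor (le_denomLoc x V)) (ρ e) = _
    rw [h2]; rfl
  have hk : algebraMap A L x ^ k ≠ 0 := pow_ne_zero _ hx
  have hb := (Module.End.isUnit_iff _).1 (bijective_smul_denomLoc hx V ⟨x ^ k, k, rfl⟩)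
  apply hb.1
  rw [Module.algebraMap_end_apply, Module.algebraMap_end_apply]
  refine h3.trans (h4.trans ?_)
  rw [← Submodule.Quotient.mk_smul, Algebra.smul_def]
  simp only [map_pow]
  rw [mul_inv_cancel_left₀ hk]

theorem denomLoc_le_cons {x : A} (hx : algebraMap A L x ≠ 0) (xs : List A) :
    denomLoc x (denom L xs) ≤ denom L (x :: xs) := by
  rintro a ⟨k, hk⟩
  exact mem_denom_cons_of_pow_smul_mem hx a k hk

/-- A map from `E` to `L ⧸ denom L xs` that hits the inverses of the powers of the product of `xs`. -/
def HasDenomMap (L : Type) [Field L] [Algebra A L] (xs : List A) (E : Type) [AddCommGroup E] [Module A E] : Prop :=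
  ∃ (ρ : E →ₗ[A] L ⧸ denom L xs) (e : ℕ → E), (∀ n, ∀ x ∈ xs, x ^ n • e n = 0) ∧
    (∀ n, ρ (e n) = Submodule.Quotient.mk (listProd L xs ^ n)⁻¹) ∧
    ∀ z : E, ∃ (a : L) (n : ℕ), ρ z = Submodule.Quotient.mk a ∧ IsIntegral A (listProd L xs ^ n * a)

theorem hasDenomMap_nil : HasDenomMap L ([] : List A) A := by
  refine ⟨(Submodule.mkQ (denom L [])).restrictScalars A ∘ₗ Algebra.linearMap A L, fun _ => 1, by simp, ?_, ?_⟩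
  · intro n
    simp [listProd]
  · intro z
    refine ⟨algebraMap A L z, 0, by simp, by simpa using isIntegral_algebraMap⟩

theorem pow_smul_powLocDiv_iterate (x : A) {E : Type} [AddCommGroup E] [Module A E] (n : ℕ) (z : PowLoc x E) :
    x ^ n • (powLocDiv x)^[n] z = z := by
  induction n generalizing z with
  | zero => simp
  | succ n ih =>
    rw [Function.iterate_succ_apply, pow_succ', mul_smul, ih, smul_powLocDiv]

theorem HasDenomMap.cons {xs : List A} {E : Type} [AddCommGroup E] [Module A E]
    (h : HasDenomMap L xs E) {x : A} (hx : algebraMap A L x ≠ 0) :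
    HasDenomMap L (x :: xs) (LocQuot x E) := by
  obtain ⟨ρ, e, he, hρe, hρ⟩ := h
  obtain ⟨σ, hσ⟩ := exists_lift_powLoc hx (denom L xs) ρ
  let τ : PowLoc x E →ₗ[A] L ⧸ denom L (x :: xs) :=
    (Submodule.factor (denomLoc_le_cons hx xs)).restrictScalars A ∘ₗ σ
  have hτ : ∀ (z : PowLoc x E) (k : ℕ) (e : E) (a : L),
      x ^ k • z = toPowLoc x E e → ρ e = Submodule.Quotient.mk a →
        τ z = Submodule.Quotient.mk ((algebraMap A L x ^ k)⁻¹ * a) := by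
    intro z k e a h1 h2
    change (Submodule.factor (denomLoc_le_cons hx xs)) (σ z) = _
    rw [hσ z k e a h1 h2]; rfl
  have hker : LinearMap.range (toPowLoc x E) ≤ LinearMap.ker τ := by
    rintro _ ⟨z, rfl⟩
    obtain ⟨a, n, ha, hn⟩ := hρ z
    rw [LinearMap.mem_ker, hτ _ 0 z a (by simp) ha, Submodule.Quotient.mk_eq_zero]
    refine ⟨n, ?_⟩
    rw [pow_zero, inv_one, one_mul, listProd_cons, mul_pow, mul_assoc]
    have h0 : algebraMap A L x ^ n ∈ powSpan L (x :: xs) n := Submodule.subset_span ⟨x, by simp, rfl⟩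
    have := Submodule.smul_mem _ (⟨_, hn⟩ : integralClosure A L) h0
    rw [Algebra.smul_def, mul_comm] at this
    exact this
  refine ⟨Submodule.liftQ _ τ hker, fun n => Submodule.Quotient.mk ((powLocDiv x)^[n] (toPowLoc x E (e n))),
    ?_, ?_, ?_⟩
  · intro n y hy
    rw [← Submodule.Quotient.mk_smul, Submodule.Quotient.mk_eq_zero]
    rcases List.mem_cons.1 hy with rfl | hy
    · rw [pow_smul_powLocDiv_iterate]
      exact ⟨e n, rfl⟩
    · have hz : y ^ n • (powLocDiv x)^[n] (toPowLoc x E (e n)) = 0 := by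
        rw [← Module.End.pow_apply, ← map_smul, ← map_smul, he n y hy, map_zero, map_zero]
      rw [hz]
      exact zero_mem _
  · intro n
    rw [Submodule.liftQ_apply, hτ _ n (e n) _ (pow_smul_powLocDiv_iterate x n _) (hρe n), listProd_cons, mul_pow,
      mul_inv]
  · intro z
    obtain ⟨z, rfl⟩ := Submodule.Quotient.mk_surjective _ z
    obtain ⟨k, ε, h⟩ := exists_pow_smul_eq_toPowLoc x z
    obtain ⟨a, n, ha, hn⟩ := hρ ε
    refine ⟨(algebraMap A L x ^ k)⁻¹ * a, n + k, ?_, ?_⟩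
    · rw [Submodule.liftQ_apply, hτ z k ε a h ha]
    · have : listProd L (x :: xs) ^ (n + k) * ((algebraMap A L x ^ k)⁻¹ * a) =
          algebraMap A L (x ^ n * xs.prod ^ k) * (listProd L xs ^ n * a) := by
        rw [listProd_cons, map_mul, map_pow, map_pow, ← listProd_eq_algebraMap]
        have hk : algebraMap A L x ^ k ≠ 0 := pow_ne_zero _ hx
        field_simp
        try ring
      rw [this]
      exact isIntegral_algebraMap.mul hn

end DenominatorMap

section FrobeniusRelation

theorem exists_eq_sum_range_smul {A : Type} [CommRing A] [IsNoetherianRing A] {W : Type} [AddCommGroup W]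
    [Module A W] (U : Submodule A W) (hU : U.FG) (w : ℕ → W) (hw : ∀ n, w n ∈ U) :
    ∃ (s : ℕ) (r : ℕ → A), w s = ∑ j ∈ Finset.range s, r j • w j := by
  have hfin : Module.Finite A U := Module.Finite.iff_fg.2 hU
  have hN : IsNoetherian A U := inferInstance
  let w' : ℕ → U := fun n => ⟨w n, hw n⟩
  let f : ℕ →o Submodule A U :=
    ⟨fun n => Submodule.span A (w' '' (Finset.range n : Set ℕ)), fun a b h =>
      Submodule.span_mono (Set.image_mono (by simpa using Finset.range_mono h))⟩
  obtain ⟨s, hs⟩ := monotone_stabilizes_iff_noetherian.2 hN f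
  have h1 : w' s ∈ f s := by
    rw [hs (s + 1) (Nat.le_succ s)]
    exact Submodule.subset_span ⟨s, by simp, rfl⟩
  obtain ⟨c, hc⟩ := (Submodule.mem_span_image_finset_iff_exists_fun A).1 h1
  refine ⟨s, fun j => if h : j ∈ Finset.range s then c ⟨j, h⟩ else 0, ?_⟩
  have h2 := congrArg (Submodule.subtype U) hc
  rw [map_sum] at h2
  rw [← Finset.sum_coe_sort]
  refine Eq.trans h2.symm (Finset.sum_congr rfl fun i _ => ?_)
  simp [w']

open TensorProduct

theorem exists_frobenius_tensor_relation {A : Type} [CommRing A] [IsNoetherianRing A] {m : Ideal A} [m.IsMaximal]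
    {Y : Type} [CommRing Y] [Algebra A Y] [Algebra.IsIntegral A Y] (p : ℕ) [Fact p.Prime] [CharP A p] [CharP Y p]
    (hY : AlmostFlat m Y) {E : Type} [AddCommGroup E] [Module A E] {y : A} {rs : List A}
    (hm : ∀ x ∈ y :: rs, x ∈ m) (hE : IsRegularArtinian (y :: rs) E) {ι : Type} [Fintype ι] (x : ι → A)
    (e : ℕ → E) (he : ∀ n i, x i ^ n • e n = 0) (u : Y) (c : ι → Y)
    (h : algebraMap A Y y * u = ∑ i, c i * algebraMap A Y (x i)) :
    ∃ (s : ℕ) (r : ℕ → A), (u ^ p ^ s) ⊗ₜ[A] e (p ^ s) =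
      ∑ j ∈ Finset.range s, r j • ((u ^ p ^ j) ⊗ₜ[A] e (p ^ j) : Y ⊗[A] E) := by
  let S : Subalgebra A Y := Algebra.adjoin A (insert u (Set.range c))
  have hfin : Module.Finite A S := by
    have : (Subalgebra.toSubmodule S).FG := fg_adjoin_of_finite ((Set.finite_range c).insert u)
      fun x _ => Algebra.IsIntegral.isIntegral x
    exact Module.Finite.iff_fg.2 this
  let u' : S := ⟨u, Algebra.subset_adjoin (Set.mem_insert _ _)⟩
  let c' : ι → S := fun i => ⟨c i, Algebra.subset_adjoin (Set.mem_insert_of_mem _ ⟨i, rfl⟩)⟩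
  have hSp : CharP S p := S.val.toRingHom.charP Subtype.val_injective p
  have h' : algebraMap A S y * u' = ∑ i, c' i * algebraMap A S (x i) := by
    apply Subtype.val_injective
    simpa [u', c'] using h
  let η : ℕ → S ⊗[A] E := fun k => (u' ^ p ^ k) ⊗ₜ[A] e (p ^ k)
  have hη : ∀ k, y ^ p ^ k • η k = 0 := by
    intro k
    have h1 : y ^ p ^ k • u' ^ p ^ k = ∑ i, x i ^ p ^ k • c' i ^ p ^ k := by
      have := congrArg (· ^ p ^ k) h'
      simp only [mul_pow] at this
      rw [sum_pow_char_pow] at this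
      simp only [mul_pow] at this
      simp only [Algebra.smul_def, map_pow]
      rw [this]
      exact Finset.sum_congr rfl fun i _ => mul_comm _ _
    simp only [η]
    rw [TensorProduct.smul_tmul', h1, TensorProduct.sum_tmul]
    refine Finset.sum_eq_zero fun i _ => ?_
    rw [TensorProduct.smul_tmul, he, TensorProduct.tmul_zero]
  obtain ⟨N, hN⟩ := hY S S.val.toLinearMap
  obtain ⟨W, hW, hW'⟩ := exists_fg_of_factorization (m := m) E
    (fun M _ _ _ ψ N => exists_fg_of_isRegularArtinian (y :: rs) hm E hE Y hY M ψ N) S S.val.toLinearMap N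
    (Set.range η) (by
      intro s hs
      obtain ⟨r, α, β, hαβ⟩ := hN s hs
      refine ⟨r, α, β, hαβ, ?_⟩
      rintro _ ⟨k, rfl⟩
      have hreg : IsSMulRegular ((Fin r →₀ A) ⊗[A] E) (y ^ p ^ k) := IsSMulRegular.lTensor _ (hE.1.pow _)
      apply hreg.right_eq_zero_of_smul
      rw [← map_smul, hη, map_zero])
  exact exists_eq_sum_range_smul W hW _ fun n => hW' (η n) ⟨n, rfl⟩

end FrobeniusRelation

section FrobeniusIntegral

variable {A L : Type} [CommRing A] [Field L] [Algebra A L] (p : ℕ) [Fact p.Prime]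

open Polynomial in
theorem degree_frobenius_tail_lt {K : Type} [CommRing K] [Nontrivial K] (s : ℕ) (a : ℕ → K) (c : K) :
    (∑ j ∈ Finset.range s, C (a j) * X ^ p ^ j + C c : K[X]).degree < ((p ^ s : ℕ) : WithBot ℕ) := by
  have hp : 1 < p := (Fact.out : p.Prime).one_lt
  refine lt_of_le_of_lt (degree_add_le _ _) (max_lt ?_ ?_)
  · refine lt_of_le_of_lt (degree_sum_le _ _) ?_
    rw [Finset.sup_lt_iff (WithBot.bot_lt_coe _)]
    intro j hj
    refine lt_of_le_of_lt (degree_C_mul_X_pow_le _ _) ?_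
    exact_mod_cast Nat.pow_lt_pow_right hp (Finset.mem_range.1 hj)
  · refine lt_of_le_of_lt degree_C_le ?_
    exact_mod_cast pow_pos (zero_lt_one.trans hp) s

open Polynomial in
theorem isIntegral_of_frobenius_eq (s : ℕ) (a : ℕ → A) (c : L) (hc : IsIntegral A c) (t : L)
    (h : t ^ p ^ s = ∑ j ∈ Finset.range s, algebraMap A L (a j) * t ^ p ^ j + c) : IsIntegral A t := by
  have hY : Nontrivial (integralClosure A L) := inferInstance
  refine isIntegral_trans (A := integralClosure A L) t
    ⟨X ^ p ^ s - (∑ j ∈ Finset.range s, C (algebraMap A _ (a j)) * X ^ p ^ j + C ⟨c, hc⟩),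
      monic_X_pow_sub (degree_frobenius_tail_lt p s _ _), ?_⟩
  rw [← aeval_def]
  simp only [map_sub, map_add, map_sum, map_mul, map_pow, aeval_X, aeval_C, ← IsScalarTower.algebraMap_apply]
  rw [h, sub_eq_zero]
  rfl

open Polynomial in
theorem exists_frobenius_eq [IsAlgClosed L] (s : ℕ) (a : ℕ → A) (c : L) :
    ∃ t : L, t ^ p ^ s = ∑ j ∈ Finset.range s, algebraMap A L (a j) * t ^ p ^ j + c := by
  have hp : 1 < p := (Fact.out : p.Prime).one_lt
  have hd := degree_frobenius_tail_lt p s (fun j => algebraMap A L (a j)) c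
  obtain ⟨t, ht⟩ := IsAlgClosed.exists_root
    (X ^ p ^ s - (∑ j ∈ Finset.range s, C (algebraMap A L (a j)) * X ^ p ^ j + C c) : L[X]) (by
      rw [degree_sub_eq_left_of_degree_lt (by rwa [degree_X_pow]), degree_X_pow]
      exact_mod_cast (pow_pos (zero_lt_one.trans hp) s).ne')
  refine ⟨t, ?_⟩
  rw [IsRoot.def] at ht
  simp only [eval_sub, eval_add, eval_finsetSum, eval_mul, eval_pow, eval_X, eval_C] at ht
  exact sub_eq_zero.1 ht

theorem exists_mem_denom_frobenius_eq_of_mem_powSpan [IsAlgClosed L] [CharP L p] {xs : List A}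
    (hP : listProd L xs ≠ 0) (s : ℕ) (r : ℕ → A) (n : ℕ) {z : L} (hz : z ∈ powSpan L xs n) :
    ∀ c : integralClosure A L, ∃ b ∈ denom L xs,
      b ^ p ^ s = ∑ j ∈ Finset.range s, algebraMap A L (r j) * b ^ p ^ j +
        (c : L) * z * (listProd L xs ^ n)⁻¹ := by
  have hp : 1 < p := (Fact.out : p.Prime).one_lt
  unfold powSpan at hz
  induction hz using Submodule.span_induction with
  | mem z h =>
    intro c
    obtain ⟨x, hx, rfl⟩ := h
    obtain ⟨d, hd⟩ := exists_listProd_eq_mul (L := L) hx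
    have hx0 : algebraMap A L x ≠ 0 := left_ne_zero_of_mul (hd ▸ hP)
    have hd0 : algebraMap A L d ≠ 0 := right_ne_zero_of_mul (hd ▸ hP)
    obtain ⟨b, hb⟩ := exists_frobenius_eq p s r ((c : L) * algebraMap A L x ^ n * (listProd L xs ^ n)⁻¹)
    refine ⟨b, ⟨n, ?_⟩, hb⟩
    have hint : IsIntegral A (algebraMap A L d ^ n * b) := by
      refine isIntegral_of_frobenius_eq p s (fun j => r j * d ^ (n * (p ^ s - p ^ j)))
        (algebraMap A L (d ^ (n * (p ^ s - 1))) * c) (isIntegral_algebraMap.mul c.2) _ ?_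
      rw [mul_pow, hb, mul_add, Finset.mul_sum]
      congr 1
      · refine Finset.sum_congr rfl fun j hj => ?_
        have hle : p ^ j ≤ p ^ s := Nat.pow_le_pow_right (zero_lt_one.trans hp) (Finset.mem_range.1 hj).le
        rw [map_mul, map_pow, mul_pow, ← pow_mul, ← pow_mul]
        have : n * p ^ s = n * (p ^ s - p ^ j) + n * p ^ j := by rw [← mul_add, Nat.sub_add_cancel hle]
        rw [this, pow_add]; ring
      · have hle : 1 ≤ p ^ s := Nat.one_le_pow _ _ (zero_lt_one.trans hp)
        have : n * p ^ s = n * (p ^ s - 1) + n := by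
          rw [← mul_one (n * (p ^ s - 1) + n), mul_one]
          conv_lhs => rw [← Nat.sub_add_cancel hle]
          ring
        rw [← pow_mul, this, pow_add, map_pow, hd, mul_pow]
        field_simp
    have h1 := Submodule.smul_mem (powSpan L xs n) (⟨_, hint⟩ : integralClosure A L)
      (Submodule.subset_span ⟨x, hx, rfl⟩)
    rw [Algebra.smul_def] at h1
    convert h1 using 1
    rw [hd, mul_pow]
    change _ = algebraMap A L d ^ n * b * algebraMap A L x ^ n
    ring
  | zero => exact fun c => ⟨0, zero_mem _, by
      have : ∀ j, (0 : L) ^ p ^ j = 0 := fun j => zero_pow (pow_pos (zero_lt_one.trans hp) j).ne'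
      simp [this]⟩
  | add z w _ _ hz hw =>
    intro c
    obtain ⟨b, hb, h1⟩ := hz c
    obtain ⟨b', hb', h2⟩ := hw c
    refine ⟨b + b', add_mem hb hb', ?_⟩
    simp only [add_pow_char_pow, h1, h2, mul_add, add_mul, Finset.sum_add_distrib]
    ring
  | smul k z _ hz =>
    intro c
    obtain ⟨b, hb, h⟩ := hz (c * k)
    refine ⟨b, hb, h.trans ?_⟩
    rw [Algebra.smul_def]
    change _ + (c : L) * (k : L) * z * _ = _ + (c : L) * ((k : L) * z) * _
    ring

theorem mem_denom_of_frobenius_sub_mem [IsAlgClosed L] [CharP L p] {xs : List A} (hxs : xs ≠ [])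
    (hP : listProd L xs ≠ 0) (s : ℕ) (r : ℕ → A) (t : L)
    (ht : t ^ p ^ s - ∑ j ∈ Finset.range s, algebraMap A L (r j) * t ^ p ^ j ∈ denom L xs) : t ∈ denom L xs := by
  obtain ⟨n, hn⟩ := ht
  obtain ⟨b, hb, h⟩ := exists_mem_denom_frobenius_eq_of_mem_powSpan p hP s r n hn 1
  have hPn := pow_ne_zero n hP
  have h3 : ∀ z : L, ((1 : integralClosure A L) : L) * (listProd L xs ^ n * z) * (listProd L xs ^ n)⁻¹ = z := by
    intro z
    rw [OneMemClass.coe_one, one_mul, mul_comm, inv_mul_cancel_left₀ hPn]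
  rw [h3] at h
  have hint : IsIntegral A (t - b) := by
    refine isIntegral_of_frobenius_eq p s r 0 isIntegral_zero _ ?_
    simp only [sub_pow_char_pow, mul_sub, Finset.sum_sub_distrib, h]
    ring
  have := add_mem (coe_mem_denom hxs ⟨_, hint⟩) hb
  simpa using this

end FrobeniusIntegral

section ColonInPerfect

theorem mem_span_range_of_prod_pow_mul_mem {Y ι : Type} [CommRing Y] [Fintype ι] [DecidableEq ι] (f : ι → Y)
    (hf : ∀ a : ι → ℕ, LechIndependent fun i => f i ^ a i) (n : ℕ) (u : Y) (s : Finset ι)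
    (hu : (∏ i ∈ s, f i ^ n) * u ∈ Ideal.span (Set.range fun i => f i ^ if i ∈ s then n + 1 else 1)) :
    u ∈ Ideal.span (Set.range f) := by
  induction s using Finset.induction_on with
  | empty => simpa using hu
  | insert j s hj ih =>
    apply ih
    have key := (hf fun i => if i ∈ insert j s then n + 1 else 1).colon (j := j) (g := f j ^ n) (h := f j)
      (c := (∏ i ∈ s, f i ^ n) * u) (by simp [pow_succ])
      (by convert hu using 1; rw [Finset.prod_insert hj]; ring)
    convert key using 3
    funext i
    by_cases h : i = j
    · subst h; simp [hj]
    · simp [h]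

theorem lechIndependent_get_cons {Y : Type} [CommRing Y] (y : Y) (l : List Y)
    (hl : LechIndependent l.get) (hy : ∀ b, y * b ∈ Ideal.span {x | x ∈ l} → b ∈ Ideal.span {x | x ∈ l}) :
    LechIndependent (y :: l).get := by
  rw [← Set.range_list_get] at hy
  intro b hb
  have hle : Ideal.span (Set.range l.get) ≤ Ideal.span (Set.range (y :: l).get) := by
    rw [Set.range_list_get, Set.range_list_get]
    exact Ideal.span_mono fun a ha => List.mem_cons_of_mem _ ha
  have hmem : y ∈ Ideal.span (Set.range (y :: l).get) := Ideal.subset_span ⟨⟨0, by simp⟩, rfl⟩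
  replace hb : b ⟨0, by simp⟩ * y + ∑ i : Fin l.length, b i.succ * l.get i = 0 := by
    rw [← hb]
    exact (Fin.sum_univ_succ (n := l.length) fun i => b i * (y :: l).get i).symm
  have h0 : b ⟨0, by simp⟩ ∈ Ideal.span (Set.range l.get) := by
    apply hy
    rw [mul_comm, eq_neg_of_add_eq_zero_left hb, neg_mem_iff]
    exact mem_span_range_iff_exists_sum.2 ⟨_, rfl⟩
  obtain ⟨c, hc⟩ := mem_span_range_iff_exists_sum.1 h0
  have h1 := hl (fun i => b i.succ + y * c i) (by
    rw [← hb, ← hc, Finset.sum_mul, ← Finset.sum_add_distrib]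
    exact Finset.sum_congr rfl fun i _ => by ring)
  intro i
  refine Fin.cases (motive := fun i : Fin (l.length + 1) => b i ∈ Ideal.span (Set.range (y :: l).get)) ?_ ?_ i
  · exact hle h0
  · intro i
    have := sub_mem (hle (h1 i)) (Ideal.mul_mem_right (c i) _ hmem)
    simpa using this

end ColonInPerfect

section FrobeniusColon

open TensorProduct

variable {A L : Type} [CommRing A] [Field L] [Algebra A L]

theorem exists_mem_span_of_mem_powSpan {xs : List A} {n : ℕ} {z : L} (hz : z ∈ powSpan L xs n) :
    ∃ v ∈ Ideal.span (Set.range fun i : Fin xs.length => algebraMap A (integralClosure A L) (xs.get i) ^ n),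
      (v : L) = z := by
  unfold powSpan at hz
  induction hz using Submodule.span_induction with
  | mem z h =>
    obtain ⟨x, hx, rfl⟩ := h
    obtain ⟨i, rfl⟩ := List.get_of_mem hx
    exact ⟨_, Ideal.subset_span ⟨i, rfl⟩, rfl⟩
  | zero => exact ⟨0, zero_mem _, rfl⟩
  | add z w _ _ hz hw =>
    obtain ⟨a, ha, rfl⟩ := hz
    obtain ⟨b, hb, rfl⟩ := hw
    exact ⟨a + b, add_mem ha hb, rfl⟩
  | smul c z _ hz =>
    obtain ⟨a, ha, rfl⟩ := hz
    exact ⟨c * a, Ideal.mul_mem_left _ _ ha, rfl⟩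

theorem exists_pow_eq_integralClosure [IsAlgClosed L] {p : ℕ} (hp : 0 < p) (y : integralClosure A L) :
    ∃ z : integralClosure A L, z ^ p = y := by
  obtain ⟨z, hz⟩ := IsAlgClosed.exists_pow_nat_eq (y : L) hp
  exact ⟨⟨z, IsIntegral.of_pow hp (hz ▸ y.2)⟩, Subtype.val_injective (by simpa using hz)⟩

theorem mem_span_of_mem_denom [IsAlgClosed L] {p : ℕ} [hp : Fact p.Prime] [CharP L p] {xs : List A}
    (hP : listProd L xs ≠ 0)
    (hlech : LechIndependent (xs.map (algebraMap A (integralClosure A L))).get) (u : integralClosure A L)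
    (hu : (u : L) * (listProd L xs)⁻¹ ∈ denom L xs) :
    u ∈ Ideal.span (Set.range fun i : Fin xs.length => algebraMap A (integralClosure A L) (xs.get i)) := by
  have hlech' : LechIndependent fun i : Fin xs.length => algebraMap A (integralClosure A L) (xs.get i) := by
    have hc : ∀ (l : List (integralClosure A L)) (g : Fin xs.length → integralClosure A L)
      (e : l.length = xs.length), (∀ i, l.get (Fin.cast e.symm i) = g i) → LechIndependent l.get →
        LechIndependent g := by
      intro l g e hg h
      generalize hk : xs.length = k at *
      subst e
      have : l.get = g := funext hg
      exact this ▸ h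
    exact hc _ _ (by simp) (by simp) hlech
  have hYp : CharP (integralClosure A L) p :=
    (integralClosure A L).val.toRingHom.charP Subtype.val_injective p
  have hpow := hlech'.pow (p := p) (exists_pow_eq_integralClosure hp.out.pos)
    (fun y hy => pow_eq_zero_iff hp.out.pos.ne' |>.1 hy)
  obtain ⟨n, hn⟩ := hu
  have h1 := pow_mul_mem_powSpan 1 n hn
  obtain ⟨v, hv, hv'⟩ := exists_mem_span_of_mem_powSpan h1
  refine mem_span_range_of_prod_pow_mul_mem _ hpow n u Finset.univ ?_
  have : (∏ i : Fin xs.length, algebraMap A (integralClosure A L) (xs.get i) ^ n) * u = v := by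
    apply Subtype.val_injective
    rw [hv', Finset.prod_pow]
    have h2 : ∏ i : Fin xs.length, algebraMap A (integralClosure A L) (xs.get i) =
        algebraMap A (integralClosure A L) xs.prod := by
      rw [← map_prod]
      congr 1
      simp
    rw [h2, pow_one, mul_left_comm, mul_left_comm _ (u : L), mul_inv_cancel₀ hP, mul_one, listProd_eq_algebraMap]
    exact mul_comm _ _ |>.trans (by rw [mul_comm]; rfl)
  rw [this]
  simpa using hv

theorem mem_span_of_mul_mem_of_hasDenomMap [IsNoetherianRing A] {m : Ideal A} [m.IsMaximal] [IsAlgClosed L] (p : ℕ)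
    [Fact p.Prime] [CharP L p] (hinj : Function.Injective (algebraMap A L))
    (hY : AlmostFlat m (integralClosure A L)) {E : Type} [AddCommGroup E] [Module A E] {xs rs : List A} {y : A}
    (hxs : ∀ x ∈ xs, x ≠ 0) (hy : y ≠ 0) (hm : ∀ x ∈ y :: rs, x ∈ m) (hE : IsRegularArtinian (y :: rs) E)
    (hd : HasDenomMap L xs E) (hlech : LechIndependent (xs.map (algebraMap A (integralClosure A L))).get)
    (u : integralClosure A L)
    (hu : algebraMap A (integralClosure A L) y * u ∈
      Ideal.span {x | x ∈ xs.map (algebraMap A (integralClosure A L))}) :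
    u ∈ Ideal.span {x | x ∈ xs.map (algebraMap A (integralClosure A L))} := by
  by_cases hnil : xs = []
  · subst hnil
    have h0 : algebraMap A (integralClosure A L) y * u = 0 := by simpa using hu
    have h1 : algebraMap A (integralClosure A L) y ≠ 0 := by
      intro h
      apply hy
      apply hinj
      rw [map_zero]
      exact congrArg Subtype.val h
    rw [(mul_eq_zero.1 h0).resolve_left h1]
    exact zero_mem _
  have hrange : {x | x ∈ xs.map (algebraMap A (integralClosure A L))} =
      Set.range fun i : Fin xs.length => algebraMap A (integralClosure A L) (xs.get i) := by
    ext z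
    simp only [List.mem_map, Set.mem_ofPred_eq, Set.mem_range]
    constructor
    · rintro ⟨x, hx, rfl⟩
      obtain ⟨i, rfl⟩ := List.get_of_mem hx
      exact ⟨i, rfl⟩
    · rintro ⟨i, rfl⟩
      exact ⟨_, List.get_mem _ _, rfl⟩
  rw [hrange] at hu ⊢
  have hP : listProd L xs ≠ 0 := by
    rw [listProd_eq_algebraMap, Ne, ← map_zero (algebraMap A L), hinj.eq_iff]
    have : NoZeroDivisors A := hinj.noZeroDivisors _ (map_zero _) (map_mul _)
    have : Nontrivial A := (algebraMap A L).domain_nontrivial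
    rw [List.prod_eq_zero_iff]
    exact fun h => hxs 0 h rfl
  have hAp : CharP A p := (algebraMap A L).charP hinj p
  have hYp : CharP (integralClosure A L) p :=
    (integralClosure A L).val.toRingHom.charP Subtype.val_injective p
  obtain ⟨c, hc⟩ := mem_span_range_iff_exists_sum.1 hu
  obtain ⟨ρ, e, he, hρe, -⟩ := hd
  obtain ⟨s, r, hr⟩ := exists_frobenius_tensor_relation p hY hm hE (fun i : Fin xs.length => xs.get i) e
    (fun n i => he n _ (List.get_mem _ _)) u c hc.symm
  apply mem_span_of_mem_denom (p := p) hP hlech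
  apply mem_denom_of_frobenius_sub_mem p hnil hP s r
  have h1 := congrArg (LinearMap.liftBaseChange (integralClosure A L) ρ) hr
  rw [map_sum, LinearMap.liftBaseChange_tmul, hρe, ← Submodule.Quotient.mk_smul] at h1
  have h2 : ∀ j, (LinearMap.liftBaseChange (integralClosure A L) ρ) (r j • ((u ^ p ^ j) ⊗ₜ[A] e (p ^ j))) =
      (denom L xs).mkQ (algebraMap A L (r j) * ((u : L) * (listProd L xs)⁻¹) ^ p ^ j) := by
    intro j
    rw [← algebraMap_smul (integralClosure A L) (r j), map_smul, LinearMap.liftBaseChange_tmul, hρe,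
      ← Submodule.Quotient.mk_smul, ← Submodule.Quotient.mk_smul, mul_pow, inv_pow]
    rfl
  simp only [h2] at h1
  rw [← map_sum, Submodule.mkQ_apply, Submodule.Quotient.eq] at h1
  rw [mul_pow, inv_pow]
  exact h1

theorem mem_span_append_of_mul_mem [IsNoetherianRing A] {m : Ideal A} [m.IsMaximal] [IsAlgClosed L] (p : ℕ)
    [Fact p.Prime] [CharP L p] (hinj : Function.Injective (algebraMap A L))
    (hY : AlmostFlat m (integralClosure A L)) (rs : List A) (hm : ∀ x ∈ rs, x ∈ m) (h0 : ∀ x ∈ rs, x ≠ 0) :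
    ∀ (xs : List A) (E : Type) [AddCommGroup E] [Module A E], (∀ x ∈ xs, x ≠ 0) → IsRegularArtinian rs E →
      HasDenomMap L xs E → LechIndependent (xs.map (algebraMap A (integralClosure A L))).get →
      ∀ (l₁ : List A) (y : A) (l₂ : List A), rs = l₁ ++ y :: l₂ → ∀ u : integralClosure A L,
        algebraMap A (integralClosure A L) y * u ∈
          Ideal.span (algebraMap A (integralClosure A L) '' {x | x ∈ xs ∨ x ∈ l₁}) →
        u ∈ Ideal.span (algebraMap A (integralClosure A L) '' {x | x ∈ xs ∨ x ∈ l₁}) := by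
  have himg : ∀ xs : List A, {x | x ∈ xs.map (algebraMap A (integralClosure A L))} =
      algebraMap A (integralClosure A L) '' {x | x ∈ xs} := by
    intro xs
    ext z
    simp [List.mem_map]
  induction rs with
  | nil => simp
  | cons z rs ih =>
    intro xs E _ _ hxs hE hd hlech l₁ y l₂ h u hu
    have key := mem_span_of_mul_mem_of_hasDenomMap p hinj hY hxs (h0 z (by simp)) hm hE hd hlech
    cases l₁ with
    | nil =>
      obtain ⟨rfl, rfl⟩ := List.cons.inj h
      have := key u
      rw [himg] at this
      simpa using this (by simpa using hu)
    | cons w l₁ =>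
      obtain ⟨rfl, rfl⟩ := List.cons.inj h
      have hz : algebraMap A L z ≠ 0 := by
        rw [Ne, ← map_zero (algebraMap A L), hinj.eq_iff]
        exact h0 z (by simp)
      have hset : {x | x ∈ xs ∨ x ∈ z :: l₁} = {x | x ∈ z :: xs ∨ x ∈ l₁} := by
        ext; simp only [List.mem_cons, Set.mem_ofPred_eq]; tauto
      rw [hset] at hu ⊢
      refine ih (fun x hx => hm x (List.mem_cons_of_mem _ hx)) (fun x hx => h0 x (List.mem_cons_of_mem _ hx))
        (z :: xs) (LocQuot z E) ?_ hE.locQuot (hd.cons hz) ?_ l₁ y l₂ rfl u hu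
      · intro x hx
        rcases List.mem_cons.1 hx with rfl | hx
        · exact h0 _ (by simp)
        · exact hxs x hx
      · rw [List.map_cons]
        exact lechIndependent_get_cons _ _ hlech key

/-- A regular system of parameters is a weakly regular sequence on the integral closure in an
algebraically closed field, as soon as the latter is flat up to powers of `m`. -/
theorem isWeaklyRegular_integralClosure [IsNoetherianRing A] {m : Ideal A} [m.IsMaximal] [IsAlgClosed L] (p : ℕ)
    [Fact p.Prime] [CharP L p] (hinj : Function.Injective (algebraMap A L))
    (hY : AlmostFlat m (integralClosure A L)) (rs : List A) (hm : ∀ x ∈ rs, x ∈ m) (h0 : ∀ x ∈ rs, x ≠ 0)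
    (hE : IsRegularArtinian rs A) : RingTheory.Sequence.IsWeaklyRegular (integralClosure A L) rs := by
  rw [RingTheory.Sequence.isWeaklyRegular_iff]
  intro i hi
  rw [isSMulRegular_quotient_iff_mem_of_smul_mem]
  intro u hu
  have hl : LechIndependent (([] : List A).map (algebraMap A (integralClosure A L))).get := fun b _ i => i.elim0
  have key := mem_span_append_of_mul_mem p hinj hY rs hm h0 [] A (by simp) hE hasDenomMap_nil hl
    (rs.take i) rs[i] (rs.drop (i + 1)) (by rw [List.cons_getElem_drop_succ, List.take_append_drop]) u
  have h2 : ∀ v : integralClosure A L, v ∈ (Ideal.ofList (rs.take i) • ⊤ : Submodule A (integralClosure A L)) ↔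
      v ∈ Ideal.span (algebraMap A (integralClosure A L) '' {x | x ∈ ([] : List A) ∨ x ∈ rs.take i}) := by
    intro v
    rw [Ideal.smul_top_eq_map, Submodule.restrictScalars_mem, Ideal.map_span]
    simp
  rw [h2] at hu ⊢
  rw [Algebra.smul_def] at hu
  exact key hu

end FrobeniusColon

section FlatOfRegular

open TensorProduct

variable {R : Type} [CommRing R]

theorem quotient_one_tmul_eq_zero_iff (x : R) {W : Type} [AddCommGroup W] [Module R W] (w : W) :
    (1 : R ⧸ Ideal.span {x}) ⊗ₜ[R] w = 0 ↔ ∃ w', x • w' = w := by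
  rw [← (quotTensorEquivQuotSMul W (Ideal.span {x})).map_eq_zero_iff]
  have := quotTensorEquivQuotSMul_mk_tmul (Ideal.span {x}) 1 w
  rw [map_one, one_smul] at this
  rw [this, Submodule.Quotient.mk_eq_zero, Submodule.ideal_span_singleton_smul,
    Submodule.mem_smul_pointwise_iff_exists]
  simp

theorem exists_one_tmul_quotient (x : R) {W : Type} [AddCommGroup W] [Module R W]
    (z : (R ⧸ Ideal.span {x}) ⊗[R] W) : ∃ w, (1 : R ⧸ Ideal.span {x}) ⊗ₜ[R] w = z := by
  induction z with
  | zero => exact ⟨0, tmul_zero _ _⟩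
  | tmul b w =>
    obtain ⟨r, rfl⟩ := Ideal.Quotient.mk_surjective b
    refine ⟨r • w, ?_⟩
    rw [← smul_tmul]
    congr 1
    exact (Algebra.algebraMap_eq_smul_one r).symm
  | add z w hz hw =>
    obtain ⟨a, rfl⟩ := hz
    obtain ⟨b, rfl⟩ := hw
    exact ⟨a + b, tmul_add _ _ _⟩

/-- The kernels of the maps obtained by tensoring injections with `Y` are `x`-power torsion. -/
def FlatAway (x : R) (Y : Type) [AddCommGroup Y] [Module R Y] : Prop :=
  ∀ (N M : Type) [AddCommGroup N] [AddCommGroup M] [Module R N] [Module R M] (j : N →ₗ[R] M),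
    Function.Injective j → ∀ ξ : N ⊗[R] Y, j.rTensor Y ξ = 0 → ∃ k : ℕ, x ^ k • ξ = 0

theorem FlatAway.baseChange {B : Type} [CommRing B] [Algebra R B] {z : R} {Y : Type} [AddCommGroup Y] [Module R Y]
    (h : FlatAway z Y) : FlatAway (algebraMap R B z) (B ⊗[R] Y) := by
  intro N M _ _ _ _ j hj ξ hξ
  let : Module R N := Module.compHom N (algebraMap R B)
  let : Module R M := Module.compHom M (algebraMap R B)
  have : IsScalarTower R B N := IsScalarTower.of_compHom R B N
  have : IsScalarTower R B M := IsScalarTower.of_compHom R B M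
  let eN := AlgebraTensorModule.cancelBaseChange R B B N Y
  let eM := AlgebraTensorModule.cancelBaseChange R B B M Y
  have hnat : ∀ ζ : N ⊗[B] (B ⊗[R] Y), eM (j.rTensor _ ζ) = (j.restrictScalars R).rTensor Y (eN ζ) := by
    intro ζ
    induction ζ with
    | zero => simp only [map_zero]
    | add a b ha hb => simp only [map_add, ha, hb]
    | tmul n t =>
      induction t with
      | zero => simp only [tmul_zero, map_zero]
      | add a b ha hb => simp only [tmul_add, map_add, ha, hb]
      | tmul b y =>
        simp only [eN, eM, LinearMap.rTensor_tmul, AlgebraTensorModule.cancelBaseChange_tmul]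
        rw [LinearMap.restrictScalars_apply, map_smul]
  obtain ⟨k, hk⟩ := h N M (j.restrictScalars R) hj (eN ξ) (by rw [← hnat, hξ, map_zero])
  refine ⟨k, ?_⟩
  apply eN.injective
  rw [← map_pow, map_smul, map_zero, algebraMap_smul, hk]

theorem mem_smul_of_rTensor_mem_smul (x : R) {Y Z G : Type} [AddCommGroup Y] [Module R Y] [AddCommGroup Z] [Module R Z]
    [AddCommGroup G] [Module R G] (j : Z →ₗ[R] G) (hj : ∀ z, (∃ g, x • g = j z) → ∃ z', x • z' = z)
    [Module.Flat (R ⧸ Ideal.span {x}) ((R ⧸ Ideal.span {x}) ⊗[R] Y)] (w : Z ⊗[R] Y)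
    (hw : ∃ g, x • g = j.rTensor Y w) : ∃ w', x • w' = w := by
  set B := R ⧸ Ideal.span {x} with hB
  have hinj : Function.Injective (j.baseChange B) := by
    rw [injective_iff_map_eq_zero]
    intro z hz
    obtain ⟨z, rfl⟩ := exists_one_tmul_quotient x z
    rw [LinearMap.baseChange_tmul, quotient_one_tmul_eq_zero_iff] at hz
    exact (quotient_one_tmul_eq_zero_iff x z).2 (hj z hz)
  have hinj' := Module.Flat.rTensor_preserves_injective_linearMap (M := B ⊗[R] Y) (j.baseChange B) hinj
  have hnat : ∀ ζ : Z ⊗[R] Y, AlgebraTensorModule.distribBaseChange R B G Y ((1 : B) ⊗ₜ[R] j.rTensor Y ζ) =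
      (j.baseChange B).rTensor (B ⊗[R] Y) (AlgebraTensorModule.distribBaseChange R B Z Y ((1 : B) ⊗ₜ[R] ζ)) := by
    intro ζ
    induction ζ with
    | zero => simp only [map_zero, tmul_zero]
    | add a b ha hb => simp only [map_add, tmul_add, ha, hb]
    | tmul n t =>
      simp [AlgebraTensorModule.distribBaseChange_tmul]
  rw [← quotient_one_tmul_eq_zero_iff] at hw ⊢
  apply (AlgebraTensorModule.distribBaseChange R B Z Y).injective
  apply hinj'
  rw [← hnat, hw]
  simp only [map_zero]

theorem eq_zero_of_smul_tensor_eq_zero (x : R) {Y Z G N : Type} [AddCommGroup Y] [Module R Y] [AddCommGroup Z]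
    [Module R Z] [AddCommGroup G] [Module R G] [AddCommGroup N] [Module R N] [Module.Flat R G]
    (j : Z →ₗ[R] G) (hj : Function.Injective j) (π : G →ₗ[R] N) (hπ : Function.Surjective π)
    (hex : Function.Exact j π) (hN : ∀ n : N, x • n = 0 → n = 0) (hxY : IsSMulRegular Y x)
    [Module.Flat (R ⧸ Ideal.span {x}) ((R ⧸ Ideal.span {x}) ⊗[R] Y)] (ζ : N ⊗[R] Y) (hζ : x • ζ = 0) : ζ = 0 := by
  have hex' := rTensor_exact Y hex hπ
  obtain ⟨g, rfl⟩ := LinearMap.rTensor_surjective Y hπ ζ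
  rw [← map_smul] at hζ
  obtain ⟨w, hw⟩ := (hex' _).1 hζ
  have hxG : IsSMulRegular (G ⊗[R] Y) x := IsSMulRegular.lTensor _ hxY
  obtain ⟨w', rfl⟩ := mem_smul_of_rTensor_mem_smul x j (by
    rintro z ⟨g', hg'⟩
    obtain ⟨z', rfl⟩ := (hex g').1 (hN _ (by rw [← map_smul, hg', hex.apply_apply_eq_zero]))
    exact ⟨z', hj (by rw [map_smul, hg'])⟩) w ⟨g, hw.symm⟩
  rw [map_smul] at hw
  rw [← hxG hw]
  exact hex'.apply_apply_eq_zero w'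

theorem flat_of_flat_quotient_of_flatAway {x : R} (hx : IsSMulRegular R x) {Y : Type} [AddCommGroup Y] [Module R Y]
    (hxY : IsSMulRegular Y x) [Module.Flat (R ⧸ Ideal.span {x}) ((R ⧸ Ideal.span {x}) ⊗[R] Y)]
    (h : FlatAway x Y) : Module.Flat R Y := by
  rw [Module.Flat.iff_rTensor_injective']
  intro I
  rw [injective_iff_map_eq_zero]
  intro ξ hξ
  obtain ⟨k, hk⟩ := h I R I.subtype Subtype.val_injective ξ hξ
  obtain ⟨G, _, _, _, π, hπ⟩ : ∃ (G : Type) (_ : AddCommGroup G) (_ : Module R G) (_ : Module.Free R G)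
      (π : G →ₗ[R] I), Function.Surjective π :=
    ⟨I →₀ R, inferInstance, inferInstance, inferInstance, _, Finsupp.linearCombination_id_surjective R I⟩
  have hreg : ∀ ζ : I ⊗[R] Y, x • ζ = 0 → ζ = 0 := by
    intro ζ hζ
    refine eq_zero_of_smul_tensor_eq_zero x (LinearMap.ker π).subtype Subtype.val_injective π hπ
      (LinearMap.exact_subtype_ker_map π) ?_ hxY ζ hζ
    intro n hn
    exact Subtype.val_injective (hx.right_eq_zero_of_smul (congrArg Subtype.val hn))
  clear hξ
  induction k with
  | zero => simpa using hk
  | succ k ih => exact ih (hreg _ (by rw [smul_smul, ← pow_succ', hk]))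

theorem RingTheory.Sequence.IsWeaklyRegular.quotTensor {x : R} {rs : List R} {Y : Type} [AddCommGroup Y] [Module R Y]
    (h : RingTheory.Sequence.IsWeaklyRegular Y (x :: rs)) :
    RingTheory.Sequence.IsWeaklyRegular ((R ⧸ Ideal.span {x}) ⊗[R] Y)
      (rs.map (algebraMap R (R ⧸ Ideal.span {x}))) := by
  have := ((RingTheory.Sequence.isWeaklyRegular_cons_iff' Y x rs).1 h).2
  refine (LinearEquiv.isWeaklyRegular_congr ?_ _).1 this
  exact (QuotSMulTop.equivQuotTensor x Y).extendScalarsOfSurjective Ideal.Quotient.mk_surjective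

theorem flat_of_isWeaklyRegular (n : ℕ) : ∀ (R : Type) [CommRing R] (rs : List R) (Y : Type) [AddCommGroup Y]
    [Module R Y], rs.length = n → (Ideal.ofList rs).IsMaximal → RingTheory.Sequence.IsWeaklyRegular R rs →
    RingTheory.Sequence.IsWeaklyRegular Y rs → (∀ x ∈ rs, FlatAway x Y) → Module.Flat R Y := by
  induction n with
  | zero =>
    intro R _ rs Y _ _ hl hmax _ _ _
    rw [List.length_eq_zero_iff] at hl
    subst hl
    rw [Ideal.ofList_nil] at hmax
    have : Nontrivial R := nontrivial_of_ne 0 1 fun h =>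
      hmax.ne_top ((Ideal.eq_top_iff_one _).2 (h ▸ zero_mem _))
    let : Field R := (Ring.isField_iff_maximal_bot.2 hmax).toField
    infer_instance
  | succ n ih =>
    intro R _ rs Y _ _ hl hmax hR hY hloc
    obtain ⟨x, rs, rfl⟩ := List.exists_cons_of_length_eq_add_one hl
    have hx : IsSMulRegular R x := ((RingTheory.Sequence.isWeaklyRegular_cons_iff' R x rs).1 hR).1
    have hxY : IsSMulRegular Y x := ((RingTheory.Sequence.isWeaklyRegular_cons_iff' Y x rs).1 hY).1
    have hflat : Module.Flat (R ⧸ Ideal.span {x}) ((R ⧸ Ideal.span {x}) ⊗[R] Y) := by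
      refine ih (R ⧸ Ideal.span {x}) (rs.map (algebraMap R _)) _ (by simpa using hl) ?_ ?_ hY.quotTensor ?_
      · have h1 : (Ideal.map (Ideal.Quotient.mk (Ideal.span {x})) (Ideal.ofList (x :: rs))).IsMaximal := by
          refine Ideal.IsMaximal.map_of_surjective_of_ker_le Ideal.Quotient.mk_surjective ?_
          rw [Ideal.mk_ker, Ideal.ofList_cons]
          exact le_sup_left
        rw [Ideal.map_ofList, List.map_cons, Ideal.ofList_cons,
          Ideal.Quotient.eq_zero_iff_mem.2 (Ideal.mem_span_singleton_self x), Ideal.span_singleton_zero,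
          bot_sup_eq] at h1
        exact h1
      · exact (LinearEquiv.isWeaklyRegular_congr
          (AlgebraTensorModule.rid R (R ⧸ Ideal.span {x}) (R ⧸ Ideal.span {x})) _).1 hR.quotTensor
      · intro z hz
        obtain ⟨z, h_mem, rfl⟩ := List.mem_map.1 hz
        exact (hloc z (List.mem_cons_of_mem _ h_mem)).baseChange
    exact flat_of_flat_quotient_of_flatAway hx hxY (hloc x (by simp))

end FlatOfRegular

section FlatAt

open TensorProduct

variable {A : Type} [CommRing A]

/-- The localization of `Y` at the prime `q` is flat. -/
def FlatAt (q : Ideal A) [q.IsPrime] (Y : Type) [AddCommGroup Y] [Module A Y] : Prop :=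
  ∃ (Y' : Type) (_ : AddCommGroup Y') (_ : Module A Y') (f : Y →ₗ[A] Y'),
    IsLocalizedModule q.primeCompl f ∧ Module.Flat A Y'

/-- The map `ψ` factors through a finite free module. -/
def FactorsFree {M Y : Type} [AddCommGroup M] [Module A M] [AddCommGroup Y] [Module A Y]
    (ψ : M →ₗ[A] Y) : Prop :=
  ∃ (r : ℕ) (α : M →ₗ[A] (Fin r →₀ A)) (β : (Fin r →₀ A) →ₗ[A] Y), ψ = β ∘ₗ α

variable {M Y : Type} [AddCommGroup M] [Module A M] [AddCommGroup Y] [Module A Y]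

theorem FactorsFree.of_comp {F : Type} [AddCommGroup F] [Module A F] [Module.Finite A F]
    [Module.Free A F] (α : M →ₗ[A] F) (β : F →ₗ[A] Y) : FactorsFree (β ∘ₗ α) := by
  by_cases hA : Nontrivial A
  · let b := (Module.finBasis A F).repr
    refine ⟨_, b.toLinearMap ∘ₗ α, β ∘ₗ b.symm.toLinearMap, ?_⟩
    ext x
    simp
  · rw [not_nontrivial_iff_subsingleton] at hA
    have := Module.subsingleton A Y
    exact ⟨0, 0, 0, LinearMap.ext fun _ => Subsingleton.elim _ _⟩

theorem FactorsFree.smul {ψ : M →ₗ[A] Y} (h : FactorsFree ψ) (s : A) : FactorsFree (s • ψ) := by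
  obtain ⟨r, α, β, rfl⟩ := h
  exact ⟨r, α, s • β, by rw [LinearMap.smul_comp]⟩

theorem FactorsFree.add {ψ φ : M →ₗ[A] Y} (h : FactorsFree ψ) (h' : FactorsFree φ) :
    FactorsFree (ψ + φ) := by
  obtain ⟨r, α, β, rfl⟩ := h
  obtain ⟨r', α', β', rfl⟩ := h'
  have := FactorsFree.of_comp (α.prod α') (β.coprod β')
  rwa [LinearMap.coprod_comp_prod] at this

/-- The ideal of scalars `s` such that `s • ψ` factors through a finite free module. -/
def factorIdeal (ψ : M →ₗ[A] Y) : Ideal A where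
  carrier := {s | FactorsFree (s • ψ)}
  add_mem' {a b} ha hb := by
    change FactorsFree ((a + b) • ψ)
    rw [add_smul]
    exact FactorsFree.add ha hb
  zero_mem' := by
    change FactorsFree ((0 : A) • ψ)
    exact ⟨0, 0, 0, by simp⟩
  smul_mem' c s hs := by
    change FactorsFree ((c • s) • ψ)
    rw [smul_assoc]
    exact FactorsFree.smul hs c

theorem FlatAt.exists_factorsFree_smul [IsNoetherianRing A] [Module.Finite A M] {q : Ideal A}
    [q.IsPrime] (h : FlatAt q Y) (ψ : M →ₗ[A] Y) : ∃ s ∉ q, FactorsFree (s • ψ) := by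
  obtain ⟨Y', _, _, f, hf, hflat⟩ := h
  have : Module.FinitePresentation A M := Module.finitePresentation_of_finite A M
  obtain ⟨k, α, γ, hαγ⟩ := Module.Flat.exists_factorization_of_finitePresentation (f ∘ₗ ψ)
  have : Module.FinitePresentation A (Fin k →₀ A) := Module.finitePresentation_of_finite A _
  obtain ⟨β, s, hβ⟩ := Module.FinitePresentation.exists_lift_of_isLocalizedModule q.primeCompl f γ
  obtain ⟨t, ht⟩ := Module.Finite.exists_smul_of_comp_eq_of_isLocalizedModule q.primeCompl f
    (s • ψ) (β ∘ₗ α) (by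
      rw [← LinearMap.comp_assoc, hβ, LinearMap.smul_comp, ← hαγ, LinearMap.comp_smul])
  refine ⟨(t * s : q.primeCompl), (t * s).2, ?_⟩
  have : ((t * s : q.primeCompl) : A) • ψ = (t : A) • (β ∘ₗ α) := by
    rw [Submonoid.coe_mul, mul_smul]
    exact ht
  rw [this]
  exact FactorsFree.smul ⟨k, α, β, rfl⟩ _

theorem almostFlat_of_flatAt [IsNoetherianRing A] {m : Ideal A}
    (h : ∀ (q : Ideal A) [q.IsPrime], ¬ m ≤ q → FlatAt q Y) : AlmostFlat m Y := by
  intro M _ _ _ ψ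
  have : m ≤ (factorIdeal ψ).radical := by
    rw [Ideal.radical_eq_sInf, le_sInf_iff]
    rintro q ⟨hq, hqp⟩
    by_contra hm
    obtain ⟨s, hs, hs'⟩ := (h q hm).exists_factorsFree_smul ψ
    exact hs (hq hs')
  obtain ⟨N, hN⟩ := Ideal.exists_pow_le_of_le_radical_of_fg this (IsNoetherian.noetherian m)
  exact ⟨N, fun s hs => hN hs⟩

theorem FlatAt.exists_smul_eq_zero {N : Type} [AddCommGroup N] [Module A N] {q : Ideal A}
    [q.IsPrime] (h : FlatAt q Y) (j : N →ₗ[A] M) (hj : Function.Injective j) (ξ : Y ⊗[A] N)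
    (hξ : j.lTensor Y ξ = 0) : ∃ s ∉ q, s • ξ = 0 := by
  obtain ⟨Y', _, _, f, hf, hflat⟩ := h
  have hl : IsLocalizedModule q.primeCompl (f.rTensor N) :=
    IsLocalizedModule.rTensor (R := A) A q.primeCompl (N := N) f
  have h1 : j.lTensor Y' (f.rTensor N ξ) = 0 := by
    rw [← LinearMap.comp_apply, LinearMap.lTensor_comp_rTensor, ← LinearMap.rTensor_comp_lTensor,
      LinearMap.comp_apply, hξ, map_zero]
  have h2 : f.rTensor N ξ = 0 :=
    (map_eq_zero_iff _ (Module.Flat.lTensor_preserves_injective_linearMap j hj)).1 h1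
  obtain ⟨s, hs⟩ := (IsLocalizedModule.eq_zero_iff q.primeCompl (f.rTensor N)).1 h2
  exact ⟨s, s.2, hs⟩

theorem flatAway_of_flatAt (x : A) (h : ∀ (q : Ideal A) [q.IsPrime], x ∉ q → FlatAt q Y) :
    FlatAway x Y := by
  intro N M _ _ _ _ j hj ξ hξ
  have : x ∈ (Ideal.torsionOf A (N ⊗[A] Y) ξ).radical := by
    rw [Ideal.radical_eq_sInf, Submodule.mem_sInf]
    rintro q ⟨hq, hqp⟩
    by_contra hx
    have h1 : j.lTensor Y (TensorProduct.comm A N Y ξ) = 0 := by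
      rw [← LinearMap.comm_comp_rTensor_comp_comm_eq]
      simp [hξ]
    obtain ⟨s, hs, hs'⟩ := (h q hx).exists_smul_eq_zero j hj _ h1
    refine hs (hq ?_)
    rw [Ideal.mem_torsionOf_iff]
    rwa [← map_smul, LinearEquiv.map_eq_zero_iff] at hs'
  obtain ⟨k, hk⟩ := this
  exact ⟨k, hk⟩

end FlatAt

section IntegralClosure

variable {A L : Type} [CommRing A] [Field L] [Algebra A L]

theorem flatAt_integralClosure (q : Ideal A) [q.IsPrime] [Algebra (Localization.AtPrime q) L]
    [IsScalarTower A (Localization.AtPrime q) L]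
    (h : Module.Flat (Localization.AtPrime q) (integralClosure (Localization.AtPrime q) L)) :
    FlatAt q (integralClosure A L) := by
  let f : integralClosure A L →ₗ[A] integralClosure (Localization.AtPrime q) L :=
    { toFun := fun y => ⟨y, y.2.tower_top⟩
      map_add' := fun _ _ => rfl
      map_smul' := fun _ _ => rfl }
  refine ⟨_, inferInstance, inferInstance, f, ⟨?_, ?_, ?_⟩,
    Module.Flat.trans A (Localization.AtPrime q) _⟩
  · intro s
    have hu := (IsLocalization.map_units (Localization.AtPrime q) s).map
      (Algebra.lsmul A A (integralClosure (Localization.AtPrime q) L))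
    convert hu using 1
    ext y
    simp [Algebra.smul_def]
  · intro y
    obtain ⟨s, hs⟩ := IsIntegral.exists_multiple_integral_of_isLocalization q.primeCompl (y : L) y.2
    exact ⟨(⟨_, hs⟩, s), rfl⟩
  · intro y z hyz
    exact ⟨1, by
      congr 1
      exact Subtype.ext (congrArg Subtype.val hyz :)⟩

end IntegralClosure

section RegularRing

theorem IsRegularLocalRingP.of_ringEquiv {A B : Type} [CommRing A] [CommRing B] (e : A ≃+* B)
    (h : IsRegularLocalRingP A) : IsRegularLocalRingP B := by
  classical
  obtain ⟨hN, hl, s, hs, hc⟩ := h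
  have hlB : IsLocalRing B := e.isLocalRing
  refine ⟨isNoetherianRing_of_ringEquiv A e, hlB, s.image e, ?_, ?_⟩
  · rw [Finset.coe_image, ← Ideal.map_span, hs]
    exact IsLocalRing.map_ringEquiv_maximalIdeal e
  · rw [Finset.card_image_of_injective _ e.injective, hc, ringKrullDim_eq_of_ringEquiv e]

theorem isRegularLocalRingP_of_localization {A : Type} [CommRing A] [IsLocalRing A]
    (h : IsRegularLocalRingP (Localization.AtPrime (IsLocalRing.maximalIdeal A))) :
    IsRegularLocalRingP A := by
  refine h.of_ringEquiv (IsLocalization.atUnits A (IsLocalRing.maximalIdeal A).primeCompl ?_).symm.toRingEquiv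
  intro x hx
  rw [IsUnit.mem_submonoid_iff]
  by_contra hu
  exact hx ((IsLocalRing.mem_maximalIdeal x).2 hu)

theorem ne_zero_of_isWeaklyRegular {A : Type} [CommRing A] [IsLocalRing A] (rs : List A)
    (hm : ∀ x ∈ rs, x ∈ IsLocalRing.maximalIdeal A)
    (h : RingTheory.Sequence.IsWeaklyRegular A rs) : ∀ x ∈ rs, x ≠ 0 := by
  intro x hx h0
  obtain ⟨i, hi, rfl⟩ := List.getElem_of_mem hx
  have hr := (RingTheory.Sequence.isWeaklyRegular_iff A rs).1 h i hi
  rw [h0, isSMulRegular_quotient_iff_mem_of_smul_mem] at hr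
  have h1 := hr 1 (by rw [zero_smul]; exact zero_mem _)
  have h2 : Ideal.ofList (rs.take i) ≤ IsLocalRing.maximalIdeal A :=
    Ideal.span_le.2 fun y hy => hm y (List.mem_of_mem_take hy)
  rw [smul_eq_mul, Ideal.mul_top] at h1
  exact (IsLocalRing.maximalIdeal A).ne_top_iff_one.1 (IsLocalRing.maximalIdeal.isMaximal A).ne_top (h2 h1)

theorem flat_integralClosure (p : ℕ) [Fact p.Prime] {L : Type} [Field L] [IsAlgClosed L]
    [CharP L p] (n : ℕ) : ∀ (A : Type) [CommRing A] [IsNoetherianRing A] [IsLocalRing A]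
    [Algebra A L], Function.Injective (algebraMap A L) →
    (∀ (q : Ideal A) [q.IsPrime], IsRegularLocalRingP (Localization.AtPrime q)) →
    ringKrullDim A < n → Module.Flat A (integralClosure A L) := by
  induction n with
  | zero =>
    intro A _ _ _ _ _ _ h
    exact absurd (ringKrullDim_nonneg_of_nontrivial (R := A)) (not_le.2 h)
  | succ n ih =>
    intro A _ _ _ _ hinj hreg hdim
    have hflat : ∀ (q : Ideal A) [q.IsPrime], ¬ IsLocalRing.maximalIdeal A ≤ q →
        FlatAt q (integralClosure A L) := by
      intro q _ hq
      have hu : ∀ y : q.primeCompl, IsUnit (algebraMap A L y) := fun y =>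
        IsUnit.mk0 _ fun h => y.2 (by
          rw [(map_eq_zero_iff _ hinj).1 h]
          exact zero_mem q)
      let _ : Algebra (Localization.AtPrime q) L := (IsLocalization.lift hu).toAlgebra
      have ht : IsScalarTower A (Localization.AtPrime q) L :=
        IsScalarTower.of_algebraMap_eq fun x => (IsLocalization.lift_eq hu x).symm
      refine flatAt_integralClosure q (ih _ ?_ ?_ ?_)
      · rw [RingHom.algebraMap_toAlgebra, IsLocalization.lift_injective_iff]
        intro x y
        rw [hinj.eq_iff]
        refine ⟨fun h => ?_, fun h => congrArg _ h⟩
        have := congrArg (IsLocalization.lift hu : Localization.AtPrime q →+* L) h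
        rw [IsLocalization.lift_eq, IsLocalization.lift_eq] at this
        exact hinj this
      · intro P _
        exact (hreg _).of_ringEquiv
          (IsLocalization.localizationLocalizationAtPrimeIsoLocalization q.primeCompl P).toRingEquiv
      · rw [IsLocalization.AtPrime.ringKrullDim_eq_height q]
        have hlt : q < IsLocalRing.maximalIdeal A :=
          lt_of_le_not_ge (IsLocalRing.le_maximalIdeal (Ideal.IsPrime.ne_top inferInstance)) hq
        have h1 := Ideal.height_strict_mono_of_isPrime_of_isPrime hlt
        rw [← IsLocalRing.maximalIdeal_height_eq_ringKrullDim] at hdim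
        have h2 : (IsLocalRing.maximalIdeal A).height < (n + 1 : ℕ) := by exact_mod_cast hdim
        have h3 : q.height < (n : ℕ∞) := by
          rw [Nat.cast_add, Nat.cast_one] at h2
          exact h1.trans_le (ENat.lt_add_one_iff (ENat.natCast_ne_top n) |>.1 h2)
        exact_mod_cast h3
    obtain ⟨_, hl, s, hs, hc⟩ := isRegularLocalRingP_of_localization (hreg (IsLocalRing.maximalIdeal A))
    have hs' : Ideal.ofList s.toList = IsLocalRing.maximalIdeal A := by
      rw [← hs, Ideal.ofList]
      congr 1
      ext
      simp
    have hw := isWeaklyRegular_of_ofList_eq_maximalIdeal s.card A s.toList s.length_toList hs' hc.le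
    have hm : ∀ x ∈ s.toList, x ∈ IsLocalRing.maximalIdeal A := fun x hx =>
      hs' ▸ Ideal.subset_span hx
    have hmax : (Ideal.ofList s.toList).IsMaximal := hs' ▸ inferInstance
    have h0 := ne_zero_of_isWeaklyRegular s.toList hm hw
    have hart : IsArtinian A (A ⧸ (Ideal.ofList s.toList • ⊤ : Submodule A A)) := by
      rw [smul_eq_mul, Ideal.mul_top]
      have : IsSimpleModule A (A ⧸ Ideal.ofList s.toList) := isSimpleModule_iff_isCoatom.2 hmax.out
      infer_instance
    refine flat_of_isWeaklyRegular s.card A s.toList _ s.length_toList hmax hw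
      (isWeaklyRegular_integralClosure (m := IsLocalRing.maximalIdeal A) p hinj
        (almostFlat_of_flatAt hflat) s.toList hm h0 (IsRegularArtinian.of_isWeaklyRegular _ _ hw hart))
      fun x hx => flatAway_of_flatAt x fun q _ hxq => hflat q fun hle => hxq (hle (hm x hx))

end RegularRing

section TorExact

open TensorProduct

variable {R : Type} [CommRing R]

theorem subsingleton_torGrp_succ_iff (n : ℕ) (Y N : Type) [AddCommGroup Y] [Module R Y]
    [AddCommGroup N] [Module R N] (P : ProjectiveResolution (ModuleCat.of R N)) :
    Subsingleton (TorGrp R (n + 1) Y N) ↔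
      Function.Exact ((P.complex.d (n + 2) (n + 1)).hom.lTensor Y)
        ((P.complex.d (n + 1) n).hom.lTensor Y) := by
  let F := (MonoidalCategory.tensoringLeft (ModuleCat R)).obj (ModuleCat.of R Y)
  let K := (F.mapHomologicalComplex (ComplexShape.down ℕ)).obj P.complex
  have h1 : Subsingleton (TorGrp R (n + 1) Y N) ↔ Limits.IsZero (K.homology (n + 1)) := by
    rw [← ModuleCat.isZero_iff_subsingleton]
    exact (P.isoLeftDerivedObj F (n + 1)).isZero_iff
  rw [h1, ← HomologicalComplex.exactAt_iff_isZero_homology,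
    HomologicalComplex.exactAt_iff' K (n + 2) (n + 1) n (by simp) (by simp),
    ShortComplex.ShortExact.moduleCat_exact_iff_function_exact]
  exact Iff.rfl

theorem ProjectiveResolution.exact_hom_succ {N : ModuleCat.{0} R} (P : ProjectiveResolution N) (n : ℕ) :
    Function.Exact (P.complex.d (n + 2) (n + 1)).hom (P.complex.d (n + 1) n).hom :=
  (ShortComplex.ShortExact.moduleCat_exact_iff_function_exact _).1 (P.exact_succ n)

theorem subsingleton_torGrp_of_flat (n : ℕ) (Y N : Type) [AddCommGroup Y] [Module R Y]
    [AddCommGroup N] [Module R N] [Module.Flat R Y] : Subsingleton (TorGrp R (n + 1) Y N) := by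
  let P : ProjectiveResolution (ModuleCat.of R N) := projectiveResolution _
  rw [subsingleton_torGrp_succ_iff n Y N P]
  exact Module.Flat.lTensor_exact Y (ProjectiveResolution.exact_hom_succ P n)

variable [IsLocalRing R]

theorem mem_of_sum_smul_eq_zero {Y : Type} [CommRing Y] [Algebra R Y] {ι : Type} [Fintype ι]
    {P₂ P₁ P₀ : Type} [AddCommGroup P₂] [Module R P₂] [AddCommGroup P₁] [Module R P₁]
    [AddCommGroup P₀] [Module R P₀] [Module.Projective R P₁] [Module.Projective R P₀]
    (f : P₂ →ₗ[R] P₁) (g : P₁ →ₗ[R] P₀) (π : P₀ →ₗ[R] IsLocalRing.ResidueField R)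
    (hfg : ∀ z, g (f z) = 0) (hgπ : Function.Exact g π) (hπ : Function.Surjective π)
    (hY : Function.Exact (f.lTensor Y) (g.lTensor Y)) (x : ι → R)
    (hx : Ideal.span (Set.range x) = IsLocalRing.maximalIdeal R)
    (hmin : ∀ c : ι → R, ∑ i, c i * x i = 0 → ∀ i, c i ∈ IsLocalRing.maximalIdeal R)
    (b : ι → Y) (hb : ∑ i, b i * algebraMap R Y (x i) = 0) (j : ι) :
    b j ∈ (IsLocalRing.maximalIdeal R).map (algebraMap R Y) := by
  classical
  have hxm : ∀ i, x i ∈ IsLocalRing.maximalIdeal R := fun i => hx ▸ Ideal.subset_span ⟨i, rfl⟩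
  obtain ⟨ψ, hψ⟩ := Module.projective_lifting_property
    (IsScalarTower.toAlgHom R R (IsLocalRing.ResidueField R)).toLinearMap π
    IsLocalRing.residue_surjective
  have hψ' : ∀ z, IsLocalRing.residue R (ψ z) = π z := fun z => LinearMap.congr_fun hψ z
  obtain ⟨e, he⟩ := hπ 1
  have hy : ∀ i, ∃ y, g y = x i • e := fun i => (hgπ _).1 (by
    rw [map_smul, he, Algebra.smul_def, mul_one]
    exact (IsLocalRing.residue_eq_zero_iff _).2 (hxm i))
  choose y hy using hy
  obtain ⟨θ, hθ⟩ := Module.projective_lifting_property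
    ((Fintype.linearCombination R x).codRestrict (IsLocalRing.maximalIdeal R) (fun c => by
      rw [Fintype.linearCombination_apply]
      exact sum_mem fun i _ => Ideal.mul_mem_left _ _ (hxm i)))
    ((ψ ∘ₗ g).codRestrict (IsLocalRing.maximalIdeal R) (fun z => by
      rw [← IsLocalRing.residue_eq_zero_iff, LinearMap.comp_apply, hψ']
      exact hgπ.apply_apply_eq_zero z))
    (by
      rintro ⟨r, hr⟩
      rw [← hx] at hr
      obtain ⟨c, hc⟩ := mem_span_range_iff_exists_sum.1 hr
      exact ⟨c, Subtype.ext hc⟩)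
  have hθ' : ∀ z, ∑ i, θ z i * x i = ψ (g z) := fun z =>
    congrArg Subtype.val (LinearMap.congr_fun hθ z)
  have hf : ∀ z i, θ (f z) i ∈ IsLocalRing.maximalIdeal R := fun z =>
    hmin _ (by rw [hθ', hfg, map_zero])
  have hu : ∀ k i, θ (y k) i - (if i = k then ψ e else 0) ∈ IsLocalRing.maximalIdeal R := by
    intro k
    refine hmin _ ?_
    simp only [sub_mul, Finset.sum_sub_distrib, hθ', hy, map_smul, ite_mul, zero_mul,
      Finset.sum_ite_eq', Finset.mem_univ, if_true, smul_eq_mul]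
    ring
  have hψe : ψ e - 1 ∈ IsLocalRing.maximalIdeal R := by
    rw [← IsLocalRing.residue_eq_zero_iff, map_sub, hψ', he, map_one, sub_self]
  let I := (IsLocalRing.maximalIdeal R).map (algebraMap R Y)
  let q : Y →ₗ[R] Y ⧸ I := (Ideal.Quotient.mkₐ R I).toLinearMap
  have hq : ∀ r ∈ IsLocalRing.maximalIdeal R, ∀ a : Y, r • q a = 0 := by
    intro r hr a
    rw [← map_smul]
    refine Ideal.Quotient.eq_zero_iff_mem.2 ?_
    rw [Algebra.smul_def]
    exact Ideal.mul_mem_right _ _ (Ideal.mem_map_of_mem _ hr)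
  let Φ : Y ⊗[R] P₁ →ₗ[R] Y ⧸ I :=
    (TensorProduct.lid R _).toLinearMap ∘ₗ (TensorProduct.comm R _ _).toLinearMap ∘ₗ
      TensorProduct.map q ((LinearMap.proj j) ∘ₗ θ)
  have hΦ : ∀ a z, Φ (a ⊗ₜ z) = θ z j • q a := fun a z => rfl
  have hΦf : ∀ ζ, Φ (f.lTensor Y ζ) = 0 := by
    intro ζ
    induction ζ with
    | zero => simp only [map_zero]
    | add a b ha hb => simp only [map_add, ha, hb, add_zero]
    | tmul a z =>
      rw [LinearMap.lTensor_tmul, hΦ]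
      exact hq _ (hf z j) a
  have h0 : g.lTensor Y (∑ i, b i ⊗ₜ y i) = 0 := by
    simp only [map_sum, LinearMap.lTensor_tmul, hy, ← TensorProduct.smul_tmul]
    rw [← TensorProduct.sum_tmul]
    have : ∑ i, x i • b i = 0 := by
      rw [← hb]
      exact Finset.sum_congr rfl fun i _ => by rw [Algebra.smul_def, mul_comm]
    rw [this, TensorProduct.zero_tmul]
  obtain ⟨ζ, hζ⟩ := (hY _).1 h0
  have h1 := hΦf ζ
  rw [hζ, map_sum] at h1
  have h2 : ∀ i, Φ (b i ⊗ₜ y i) = if i = j then q (b i) else 0 := by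
    intro i
    rw [hΦ]
    have := hq _ (hu i j) (b i)
    rw [sub_smul, sub_eq_zero] at this
    rw [this]
    by_cases hij : i = j
    · subst hij
      have := hq _ hψe (b i)
      rw [sub_smul, sub_eq_zero, one_smul] at this
      simp only [if_true, this]
    · simp [hij, Ne.symm hij]
  simp only [h2, Finset.sum_ite_eq', Finset.mem_univ, if_true] at h1
  exact Ideal.Quotient.eq_zero_iff_mem.1 h1

theorem exists_minimal_generators (R : Type) [CommRing R] [IsLocalRing R] [IsNoetherianRing R] :
    ∃ (n : ℕ) (x : Fin n → R), ringKrullDim R ≤ n ∧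
      Ideal.span (Set.range x) = IsLocalRing.maximalIdeal R ∧
      ∀ c : Fin n → R, ∑ i, c i * x i = 0 → ∀ i, c i ∈ IsLocalRing.maximalIdeal R := by
  have hfg : (IsLocalRing.maximalIdeal R).FG := IsNoetherian.noetherian _
  have hfin := Submodule.FG.finite_generators hfg
  have hcard := Submodule.FG.generators_ncard hfg
  have := hfin.fintype
  have e : Fin (Submodule.spanFinrank (IsLocalRing.maximalIdeal R)) ≃ (IsLocalRing.maximalIdeal R).generators :=
    (Fintype.equivFinOfCardEq (by rw [← Nat.card_eq_fintype_card]; exact hcard)).symm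
  have hrange : Set.range (fun i => (e i : R)) = (IsLocalRing.maximalIdeal R).generators := by
    ext r
    exact ⟨fun ⟨i, hi⟩ => hi ▸ (e i).2, fun hr => ⟨e.symm ⟨r, hr⟩, by simp⟩⟩
  have hspan : Ideal.span (Set.range (fun i => (e i : R))) = IsLocalRing.maximalIdeal R := by
    rw [hrange]
    exact Submodule.span_generators _
  refine ⟨_, fun i => e i, ringKrullDim_le_spanFinrank_maximalIdeal R, hspan, ?_⟩
  intro c hc i
  by_contra hi
  have hu : IsUnit (c i) := by
    by_contra h
    exact hi ((IsLocalRing.mem_maximalIdeal _).2 h)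
  let s : Set R := (fun k => (e k : R)) '' {i}ᶜ
  have hmem : (e i : R) ∈ Ideal.span s := by
    rw [← Ideal.unit_mul_mem_iff_mem _ hu]
    rw [← Finset.add_sum_erase _ _ (Finset.mem_univ i), add_eq_zero_iff_eq_neg] at hc
    rw [hc]
    refine neg_mem (sum_mem fun k hk => Ideal.mul_mem_left _ _ (Ideal.subset_span ⟨k, ?_, rfl⟩))
    simpa using hk
  have hs : Ideal.span s = IsLocalRing.maximalIdeal R := by
    refine le_antisymm (hspan ▸ Ideal.span_mono (Set.image_subset_range _ _)) ?_
    rw [← hspan, Ideal.span_le]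
    rintro _ ⟨k, rfl⟩
    by_cases hk : k = i
    · rw [hk]; exact hmem
    · exact Ideal.subset_span ⟨k, hk, rfl⟩
  have hle := Submodule.spanFinrank_span_le_ncard_of_finite (R := R) (Set.toFinite s)
  have hs2 : (Submodule.span R s).spanFinrank = (IsLocalRing.maximalIdeal R).spanFinrank :=
    congrArg Submodule.spanFinrank hs
  rw [hs2] at hle
  have hlt : s.ncard < Submodule.spanFinrank (IsLocalRing.maximalIdeal R) := by
    refine (Set.ncard_image_le (Set.toFinite _)).trans_lt ?_
    have h3 := Set.ncard_lt_ncard (s := ({i}ᶜ : Set (Fin (Submodule.spanFinrank (IsLocalRing.maximalIdeal R)))))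
      (t := Set.univ) (by
        rw [Set.ssubset_univ_iff]
        intro h
        have : i ∈ ({i}ᶜ : Set _) := h ▸ Set.mem_univ i
        exact this rfl)
    rwa [Set.ncard_univ, Nat.card_fin] at h3
  exact absurd hle (not_le.2 hlt)

end TorExact

section RegularOfTor

variable {R : Type} [CommRing R] [IsDomain R] [IsNoetherianRing R] [IsLocalRing R]

theorem isRegularLocalRingP_of_subsingleton_torGrp (p : ℕ) [Fact p.Prime]
    [CharP (AlgebraicClosure (FractionRing R)) p]
    (h : Subsingleton (TorGrp R 1 (AbsIntClo R) (IsLocalRing.ResidueField R))) :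
    IsRegularLocalRingP R := by
  classical
  obtain ⟨n, x, hdim, hx, hmin⟩ := exists_minimal_generators R
  have hxm : ∀ i, x i ∈ IsLocalRing.maximalIdeal R := fun i => hx ▸ Ideal.subset_span ⟨i, rfl⟩
  have hmap : (IsLocalRing.maximalIdeal R).map (algebraMap R (AbsIntClo R)) =
      Ideal.span (Set.range fun i => algebraMap R (AbsIntClo R) (x i)) := by
    rw [← hx, Ideal.map_span, ← Set.range_comp]
    rfl
  have hind : LechIndependent fun i => algebraMap R (AbsIntClo R) (x i) := by
    intro b hb j
    rw [← hmap]
    let P : ProjectiveResolution (ModuleCat.of R (IsLocalRing.ResidueField R)) :=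
      projectiveResolution _
    have hproj : ∀ k, Module.Projective R (P.complex.X k) := fun k =>
      (IsProjective.iff_projective _).2 (P.projective k)
    have := hproj 1
    have := hproj 0
    refine mem_of_sum_smul_eq_zero (P.complex.d 2 1).hom (P.complex.d 1 0).hom (P.π.f 0).hom
      (ProjectiveResolution.exact_hom_succ P 0).apply_apply_eq_zero
      ((ShortComplex.ShortExact.moduleCat_exact_iff_function_exact _).1 P.exact₀)
      ((ModuleCat.epi_iff_surjective _).1 inferInstance)
      ((subsingleton_torGrp_succ_iff 0 _ _ P).1 h) x hx hmin b hb j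
  have hcomap : ∀ r : R, algebraMap R (AbsIntClo R) r ∈
      Ideal.span (Set.range fun i => algebraMap R (AbsIntClo R) (x i)) → r ∈ Ideal.span (Set.range x) := by
    intro r hr
    rw [← hmap] at hr
    rw [hx]
    obtain ⟨Q, hQ, hQm⟩ := Ideal.exists_ideal_over_maximal_of_isIntegral (S := AbsIntClo R)
      (IsLocalRing.maximalIdeal R) (IsLocalRing.le_maximalIdeal (RingHom.ker_ne_top _))
    rw [← hQm, Ideal.mem_comap]
    exact Ideal.map_le_iff_le_comap.2 hQm.ge hr
  have := (integralClosure R (AlgebraicClosure (FractionRing R))).val.toRingHom.charP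
    Subtype.val_injective p
  have hle := le_ringKrullDim_of_isSMulRegular_mod x hx
    (mem_span_image_of_mul_mem_of_lechIndependent (Y := AbsIntClo R) x hxm
      (LechIndependent.pow (exists_pow_eq_integralClosure (Fact.out : p.Prime).pos)
        (fun _ hy => eq_zero_of_pow_eq_zero hy) hind) hcomap)
  refine ⟨inferInstance, inferInstance, Finset.univ.image x, by simpa using hx, ?_⟩
  refine le_antisymm (le_trans ?_ hle) ?_
  · exact_mod_cast Finset.card_image_le.trans_eq (Finset.card_fin n)
  · refine (ringKrullDim_le_spanFinrank_maximalIdeal R).trans ?_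
    have h2 := Submodule.spanFinrank_span_le_ncard_of_finite (R := R) (Finset.univ.image x).finite_toSet
    rw [Set.ncard_coe_finset] at h2
    have h3 : Submodule.span R (↑(Finset.univ.image x) : Set R) = IsLocalRing.maximalIdeal R := by
      rw [← hx, Finset.coe_image, Finset.coe_univ, Set.image_univ]
    rw [h3] at h2
    exact_mod_cast h2

end RegularOfTor

/-- Let `(R, 𝔪)` be an excellent local domain of prime characteristic `p` and let `𝔞` be
an ideal defining the singular locus of `R`. If `Tor_1^R(R⁺, k) = 0`, then
`Tor_n^R(R⁺, M) = 0` for all `n ≥ 1` and all finitely generated `R`-modules `M` such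
that `M/𝔞M` has finite length. -/
theorem tor_vanishing_of_finite_length_mod_singular_locus
    (R : Type) [CommRing R] [IsDomain R] [IsNoetherianRing R] [IsLocalRing R]
    (hExc : IsExcellentRing R)
    (p : ℕ) (hp : p.Prime) [CharP R p]
    (𝔞 : Ideal R)
    (h𝔞 : ∀ (q : Ideal R) (hq : q.IsPrime),
      (haveI := hq; IsRegularLocalRingP (Localization.AtPrime q)) ↔ ¬ 𝔞 ≤ q)
    (htor : Subsingleton (TorGrp R 1 (AbsIntClo R) (IsLocalRing.ResidueField R))) :
    ∀ (n : ℕ), 1 ≤ n →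
      ∀ (M : Type) (_ : AddCommGroup M) (_ : Module R M) (_ : Module.Finite R M),
        IsFiniteLength R (M ⧸ (𝔞 • ⊤ : Submodule R M)) →
        Subsingleton (TorGrp R n (AbsIntClo R) M) := by
  have : Fact p.Prime := ⟨hp⟩
  have hinj : Function.Injective (algebraMap R (AlgebraicClosure (FractionRing R))) := by
    rw [IsScalarTower.algebraMap_eq R (FractionRing R)]
    exact (algebraMap (FractionRing R) _).injective.comp (IsFractionRing.injective R (FractionRing R))
  have : CharP (AlgebraicClosure (FractionRing R)) p := charP_of_injective_algebraMap hinj p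
  have hreg := isRegularLocalRingP_of_subsingleton_torGrp p htor
  have htop : 𝔞 = ⊤ := by
    by_contra h
    refine (h𝔞 (IsLocalRing.maximalIdeal R) inferInstance).1 ?_ (IsLocalRing.le_maximalIdeal h)
    refine hreg.of_ringEquiv (IsLocalization.atUnits R (IsLocalRing.maximalIdeal R).primeCompl ?_).toRingEquiv
    intro x hx
    rw [IsUnit.mem_submonoid_iff]
    by_contra hu
    exact hx ((IsLocalRing.mem_maximalIdeal x).2 hu)
  obtain ⟨d, hd⟩ : ∃ d : ℕ, ringKrullDim R < d := by
    obtain ⟨-, -, s, -, hs⟩ := hreg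
    exact ⟨s.card + 1, by rw [← hs]; exact_mod_cast Nat.lt_succ_self _⟩
  have hflat : Module.Flat R (AbsIntClo R) :=
    flat_integralClosure p d R hinj (fun q _ => (h𝔞 q inferInstance).2 fun hle =>
      Ideal.IsPrime.ne_top (I := q) inferInstance (top_le_iff.1 (htop ▸ hle))) hd
  intro n hn M _ _ _ _
  obtain ⟨n, rfl⟩ := Nat.exists_eq_succ_of_ne_zero (Nat.one_le_iff_ne_zero.1 hn)
  exact subsingleton_torGrp_of_flat n _ M
end

section
/- Let (A, 𝔪) be an Artinian local ring of embedding dimension one (i.e. 𝔪 is a nonzero principal ideal) and let M be an arbitrary A-module. Let I = ann_A(𝔪) be the socle ideal of A. Then M is a flat A-module if and only if ann_M(I) = 𝔪M, where ann_M(I) = {μ ∈ M : aμ = 0 for all a ∈ I}. -/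
set_option synthInstance.maxHeartbeats 1000000
set_option maxHeartbeats 1000000
set_option linter.unusedVariables false

open CategoryTheory

namespace Module.Flat

variable {R M : Type*} [CommRing R] [AddCommGroup M] [Module R M]

open TensorProduct in
/-- A module over a principal ideal ring is flat if every relation `a • m = 0` is trivial. -/
theorem of_forall_smul_eq_zero [IsPrincipalIdealRing R]
    (h : ∀ (a : R) (m : M), a • m = 0 → ∃ (b : R) (m' : M), a * b = 0 ∧ m = b • m') :
    Module.Flat R M := by
  rw [iff_lift_lsmul_comp_subtype_injective]
  intro I _
  obtain ⟨a, rfl⟩ := (IsPrincipalIdealRing.principal I).principal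
  let g : Submodule.span R {a} := ⟨a, Submodule.mem_span_singleton_self a⟩
  have eq_tmul (t : Submodule.span R {a} ⊗[R] M) : ∃ m : M, t = g ⊗ₜ[R] m := by
    induction t with
    | zero => exact ⟨0, (tmul_zero _ _).symm⟩
    | tmul r m =>
      obtain ⟨r, hr⟩ := r
      obtain ⟨c, rfl⟩ := Submodule.mem_span_singleton.mp hr
      exact ⟨c • m, smul_tmul c g m⟩
    | add t₁ t₂ h₁ h₂ =>
      obtain ⟨m₁, rfl⟩ := h₁
      obtain ⟨m₂, rfl⟩ := h₂
      exact ⟨m₁ + m₂, (tmul_add _ _ _).symm⟩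
  refine (injective_iff_map_eq_zero _).mpr fun t ht ↦ ?_
  obtain ⟨m, rfl⟩ := eq_tmul t
  obtain ⟨b, m', hab, rfl⟩ := h a m (by simpa [g] using ht)
  have hg : b • g = 0 := Subtype.ext (by simpa [g, mul_comm] using hab)
  rw [← smul_tmul, hg, zero_tmul]

/-- If `M` is flat and `a • m = 0`, then `m ∈ I • M` for every ideal `I` containing the
annihilator of `a`. -/
theorem mem_smul_top_of_smul_eq_zero [Module.Flat R M] {I : Ideal R} {a : R} {m : M}
    (hI : ∀ b, a * b = 0 → b ∈ I) (h : a • m = 0) : m ∈ (I • ⊤ : Submodule R M) := by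
  obtain ⟨k, b, y, hm, hb⟩ := isTrivialRelation_of_sum_smul_eq_zero
    (ι := Unit) (f := fun _ ↦ a) (x := fun _ ↦ m) (by simpa using h)
  rw [show m = _ from hm ()]
  exact sum_mem fun j _ ↦ Submodule.smul_mem_smul (hI _ (by simpa using hb j)) trivial

end Module.Flat

namespace IsLocalRing

variable {R : Type*} [CommRing R] [IsLocalRing R] {x : R}

theorem exists_eq_unit_mul_pow_or_exists_eq_mul_pow (hx : maximalIdeal R = Ideal.span {x})
    (n : ℕ) (a : R) : (∃ k < n, ∃ u : Rˣ, a = u * x ^ k) ∨ ∃ b, a = b * x ^ n := by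
  induction n with
  | zero => exact .inr ⟨a, by simp⟩
  | succ n ih =>
    obtain ⟨k, hk, u, rfl⟩ | ⟨b, rfl⟩ := ih
    · exact .inl ⟨k, by omega, u, rfl⟩
    · by_cases hb : IsUnit b
      · exact .inl ⟨n, by omega, hb.unit, rfl⟩
      · rw [← mem_nonunits_iff, ← mem_maximalIdeal, hx, Ideal.mem_span_singleton'] at hb
        obtain ⟨c, rfl⟩ := hb
        exact .inr ⟨c, by ring⟩

/-- In a local ring with nilpotent principal maximal ideal `(x)`, every nonzero element is a
unit multiple of a power of `x`. -/
theorem exists_eq_unit_mul_pow (hx : maximalIdeal R = Ideal.span {x}) {n : ℕ}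
    (hn : x ^ n = 0) {a : R} (ha : a ≠ 0) : ∃ k < n, ∃ u : Rˣ, a = u * x ^ k := by
  refine (exists_eq_unit_mul_pow_or_exists_eq_mul_pow hx n a).resolve_right ?_
  rintro ⟨b, rfl⟩
  exact ha (by rw [hn, mul_zero])

theorem isPrincipalIdealRing_of_isNilpotent (hx : maximalIdeal R = Ideal.span {x})
    (hnil : IsNilpotent x) : IsPrincipalIdealRing R := by
  classical
  obtain ⟨n, hn⟩ := hnil
  refine ⟨fun I ↦ ?_⟩
  have hex : ∃ k, x ^ k ∈ I := ⟨n, hn ▸ I.zero_mem⟩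
  refine ⟨x ^ Nat.find hex, le_antisymm (fun a ha ↦ ?_) ?_⟩
  · obtain rfl | ha0 := eq_or_ne a 0
    · exact zero_mem _
    · obtain ⟨k, -, u, rfl⟩ := exists_eq_unit_mul_pow hx hn ha0
      have hk : x ^ k ∈ I := (Ideal.unit_mul_mem_iff_mem I u.isUnit).mp ha
      exact Ideal.mem_span_singleton.mpr
        ((pow_dvd_pow x (Nat.find_min' hex hk)).mul_left _)
  · exact (Ideal.span_singleton_le_iff_mem I).mpr (Nat.find_spec hex)

/-- If the maximal ideal is `(x)` with `x ^ n ≠ 0` and `x ^ (n + 1) = 0`, then the socle is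
contained in `(x ^ n)`. -/
theorem pow_dvd_of_mem_annihilator_maximalIdeal (hx : maximalIdeal R = Ideal.span {x}) {n : ℕ}
    (hn0 : x ^ n ≠ 0) (hn : x ^ (n + 1) = 0) {a : R} (ha : a ∈ (maximalIdeal R).annihilator) :
    x ^ n ∣ a := by
  obtain rfl | ha0 := eq_or_ne a 0
  · exact dvd_zero _
  obtain ⟨k, -, u, rfl⟩ := exists_eq_unit_mul_pow hx hn ha0
  rw [hx, Submodule.mem_annihilator_span_singleton, smul_eq_mul, mul_assoc, ← pow_succ,
    Units.mul_right_eq_zero] at ha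
  have hk : n ≤ k := by
    by_contra! hlt
    exact hn0 (pow_eq_zero_of_le hlt ha)
  exact (pow_dvd_pow x hk).mul_left _

end IsLocalRing

theorem exists_eq_pow_smul_of_pow_smul_eq_zero {R M : Type*} [CommRing R] [AddCommGroup M]
    [Module R M] {x : R} {n : ℕ} (h : ∀ m : M, x ^ n • m = 0 → ∃ m' : M, m = x • m') (d : ℕ)
    {k : ℕ} (hk : k + d = n) (m : M) (hm : x ^ k • m = 0) : ∃ m' : M, m = x ^ (d + 1) • m' := by
  induction d generalizing k m with
  | zero =>
    obtain rfl : k = n := hk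
    simpa using h m hm
  | succ d ih =>
    obtain ⟨m₁, rfl⟩ := h m (by rw [← hk, add_comm, pow_add, mul_smul, hm, smul_zero])
    obtain ⟨m₂, rfl⟩ := ih (k := k + 1) (by omega) m₁ (by rwa [pow_succ, mul_smul])
    exact ⟨m₂, by rw [smul_smul, ← pow_succ']⟩

/-- Let `(A, 𝔪)` be an Artinian local ring of embedding dimension one (i.e. `𝔪` is a
nonzero principal ideal) and let `M` be an arbitrary `A`-module. Let `I = ann_A(𝔪)` be
the socle of `A`. Then `M` is flat iff `ann_M(I) = 𝔪M`. -/
theorem flat_iff_annihilator_socle_eq_smul_top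
    (A : Type) [CommRing A] [IsArtinianRing A] [IsLocalRing A]
    (hemb : IsLocalRing.maximalIdeal A ≠ ⊥ ∧
      ∃ x : A, IsLocalRing.maximalIdeal A = Ideal.span {x})
    (M : Type) [AddCommGroup M] [Module A M] :
    Module.Flat A M ↔
      ∀ m : M, (∀ a ∈ (IsLocalRing.maximalIdeal A).annihilator, a • m = 0) ↔
        m ∈ (IsLocalRing.maximalIdeal A • ⊤ : Submodule A M) := by
  obtain ⟨hne, x, hx⟩ := hemb
  have hnil : IsNilpotent x := by
    rw [← mem_nilradical, Ring.KrullDimLE.nilradical_eq_maximalIdeal, hx]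
    exact Ideal.mem_span_singleton_self x
  obtain ⟨n, hn, hn0⟩ : ∃ n, x ^ (n + 1) = 0 ∧ x ^ n ≠ 0 :=
    ⟨nilpotencyClass x - 1, by
      rw [Nat.sub_add_cancel (pos_nilpotencyClass_iff.mpr hnil)]
      exact pow_nilpotencyClass hnil, pow_pred_nilpotencyClass hnil⟩
  have mem_iff (m : M) :
      m ∈ (IsLocalRing.maximalIdeal A • ⊤ : Submodule A M) ↔ ∃ m', m = x • m' := by
    rw [hx, Submodule.ideal_span_singleton_smul, Submodule.mem_smul_pointwise_iff_exists]
    simp [eq_comm]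
  have pow_mem : x ^ n ∈ (IsLocalRing.maximalIdeal A).annihilator := by
    rw [hx, Submodule.mem_annihilator_span_singleton, smul_eq_mul, ← pow_succ, hn]
  refine ⟨fun hflat m ↦ ⟨fun h ↦ ?_, fun hm a ha ↦ ?_⟩, fun h ↦ ?_⟩
  · refine Module.Flat.mem_smul_top_of_smul_eq_zero (fun b hb ↦ ?_) (h _ pow_mem)
    rw [IsLocalRing.mem_maximalIdeal, mem_nonunits_iff]
    exact fun hu ↦ hn0 (hu.mul_left_eq_zero.mp hb)
  · obtain ⟨m', rfl⟩ := (mem_iff m).mp hm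
    rw [hx, Submodule.mem_annihilator_span_singleton, smul_eq_mul] at ha
    rw [smul_smul, ha, zero_smul]
  · have hpow (m : M) (hm : x ^ n • m = 0) : ∃ m', m = x • m' := by
      refine (mem_iff m).mp ((h m).mp fun a ha ↦ ?_)
      obtain ⟨c, rfl⟩ := IsLocalRing.pow_dvd_of_mem_annihilator_maximalIdeal hx hn0 hn ha
      rw [mul_comm, mul_smul, hm, smul_zero]
    have := IsLocalRing.isPrincipalIdealRing_of_isNilpotent hx hnil
    refine Module.Flat.of_forall_smul_eq_zero fun a m ham ↦ ?_
    obtain rfl | ha := eq_or_ne a 0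
    · exact ⟨1, m, by simp, by simp⟩
    obtain ⟨k, hk, u, rfl⟩ := IsLocalRing.exists_eq_unit_mul_pow hx hn ha
    have hkm : x ^ k • m = 0 := by
      rwa [mul_smul, u.isUnit.smul_eq_zero] at ham
    obtain ⟨m', rfl⟩ :=
      exists_eq_pow_smul_of_pow_smul_eq_zero hpow (n - k) (by omega) m hkm
    refine ⟨_, m', ?_, rfl⟩
    rw [mul_assoc, ← pow_add, show k + (n - k + 1) = n + 1 by omega, hn, mul_zero]
end
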